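/- Let 1 ≤ p < ∞. Suppose (φ_t)_{t≥0} is a semigroup of analytic self-maps of 𝔻 and (m_t)_{t≥0} is a pointwise continuous cocycle for (φ_t). If limsup_{t→0⁺} ‖m_t‖_{H^∞} < ∞, then each m_t is bounded on 𝔻, each weighted composition operator S_t f = m_t · (f ∘ φ_t) is bounded on the Hardy space H^p, and the semigroup (S_t)_{t≥0} is strongly continuous on H^p. -/

import Mathlib

open Complex MeasureTheory Set Filter Metric Topology

/-- The `p`-th power integral mean of `f` over the circle of radius `r`,
`(2π)⁻¹ ∫_0^{2π} ‖f(r e^{iθ})‖^p dθ`. -/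
noncomputable def hardyMeanP (p : ℝ) (f : ℂ → ℂ) (r : ℝ) : ℝ :=
  (2 * Real.pi)⁻¹ * ∫ θ in (0:ℝ)..(2 * Real.pi), ‖f ((r : ℂ) * Complex.exp ((θ : ℂ) * Complex.I))‖ ^ p

/-- The Hardy space norm `‖f‖_{H^p} = (sup_{0<r<1} (2π)⁻¹ ∫_0^{2π} ‖f(re^{iθ})‖^p dθ)^{1/p}`. -/
noncomputable def hardyNorm (p : ℝ) (f : ℂ → ℂ) : ℝ :=
  (⨆ r : Set.Ioo (0:ℝ) 1, hardyMeanP p f (r : ℝ)) ^ (1 / p)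

/-- Membership in the Hardy space `H^p`: `f` is analytic on the unit disk `𝔻` and its integral
means over circles are uniformly bounded. -/
def MemHardy (p : ℝ) (f : ℂ → ℂ) : Prop :=
  DifferentiableOn ℂ f (Metric.ball 0 1) ∧
    BddAbove (Set.range fun r : Set.Ioo (0:ℝ) 1 => hardyMeanP p f (r : ℝ))

/-- On the unit disk, the power `‖G‖ ^ q` of the modulus of a zero-free analytic function is the
modulus of an analytic function. -/
lemma exists_differentiableOn_norm_eq_rpow {G : ℂ → ℂ} (hG : DifferentiableOn ℂ G (ball 0 1))
    (h0 : ∀ z ∈ ball (0 : ℂ) 1, G z ≠ 0) (q : ℝ) :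
    ∃ K : ℂ → ℂ, DifferentiableOn ℂ K (ball 0 1) ∧ ∀ z ∈ ball (0 : ℂ) 1, ‖K z‖ = ‖G z‖ ^ q := by
  have hG' : DifferentiableOn ℂ (deriv G) (ball 0 1) := hG.deriv isOpen_ball
  obtain ⟨L, hL⟩ := (hG'.div hG h0).isExactOn_ball
  have hD : ∀ z ∈ ball (0 : ℂ) 1, HasDerivAt (fun z => G z * exp (-L z)) 0 z := by
    intro z hz
    have h1 : HasDerivAt G (deriv G z) z :=
      (hG.differentiableAt (isOpen_ball.mem_nhds hz)).hasDerivAt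
    have h2 := h1.mul (hL z hz).neg.cexp
    refine h2.congr_deriv ?_
    have := h0 z hz
    simp only [Pi.div_apply]
    field_simp
    ring
  have hc : ∀ z ∈ ball (0 : ℂ) 1, G z * exp (-L z) = G 0 * exp (-L 0) := by
    intro z hz
    refine isOpen_ball.is_const_of_deriv_eq_zero (convex_ball (0 : ℂ) 1).isPreconnected
      (fun x hx => (hD x hx).differentiableAt.differentiableWithinAt)
      (fun x hx => (hD x hx).deriv) hz (mem_ball_self one_pos)
  obtain ⟨c, hc⟩ : ∃ c, ∀ z ∈ ball (0 : ℂ) 1, G z * exp (-L z) = c := ⟨_, hc⟩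
  refine ⟨fun z => ((‖c‖ ^ q : ℝ) : ℂ) * exp (q * L z), ?_, ?_⟩
  · intro z hz
    exact ((hL z hz).differentiableAt.const_mul _).cexp.const_mul _ |>.differentiableWithinAt
  · intro z hz
    have hGz : G z = c * exp (L z) := by
      rw [← hc z hz, mul_assoc, ← exp_add]; simp
    have h1 : ‖((‖c‖ ^ q : ℝ) : ℂ) * exp (q * L z)‖ = ‖c‖ ^ q * Real.exp (q * (L z).re) := by
      rw [norm_mul, norm_real, Real.norm_of_nonneg (by positivity), norm_exp, re_ofReal_mul]
    rw [h1, hGz, norm_mul, Real.mul_rpow (norm_nonneg _) (norm_nonneg _), norm_exp,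
      ← Real.exp_mul, mul_comm q]

/-- Poisson's kernel for the unit circle is nonnegative. -/
lemma re_herglotz_nonneg {w z : ℂ} (hw : w ∈ ball (0 : ℂ) 1) (hz : ‖z‖ = 1) :
    0 ≤ ((z + w) / (z - w)).re := by
  have h := le_re_herglotzRieszKernel (c := 0) (R := 1) (z := z) (w := w) (by simp [hz]) hw
  simp only [sub_zero] at h
  have hw' : ‖w‖ < 1 := by simpa using hw
  exact le_trans (by have := norm_nonneg w; apply div_nonneg <;> linarith) h

lemma continuousOn_re_herglotz {w : ℂ} (hw : w ∈ ball (0 : ℂ) 1) :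
    ContinuousOn (fun z : ℂ => ((z + w) / (z - w)).re) (sphere 0 1) := by
  have hw' : ‖w‖ < 1 := by simpa using hw
  refine Complex.continuous_re.comp_continuousOn (ContinuousOn.div (by fun_prop) (by fun_prop) ?_)
  intro z hz h
  have : z = w := sub_eq_zero.1 h
  simp at hz
  rw [this] at hz; linarith

/-- Poisson's inequality for `‖G‖ ^ q`, where `G` has no zeros in the open disk. -/
lemma rpow_norm_le_poisson_of_ne_zero {G : ℂ → ℂ} (hG : DifferentiableOn ℂ G (ball 0 1))
    (hGc : ContinuousOn G (closedBall 0 1)) (h0 : ∀ z ∈ ball (0 : ℂ) 1, G z ≠ 0) {q : ℝ}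
    (hq : 0 < q) {w : ℂ} (hw : w ∈ ball (0 : ℂ) 1) :
    ‖G w‖ ^ q ≤ Real.circleAverage (fun z => ((z + w) / (z - w)).re * ‖G z‖ ^ q) 0 1 := by
  obtain ⟨K, hK, hKG⟩ := exists_differentiableOn_norm_eq_rpow hG h0 q
  have hw' : ‖w‖ < 1 := by simpa using hw
  have hmem : ∀ ρ ∈ Icc (0 : ℝ) 1, ∀ z ∈ closedBall (0 : ℂ) 1,
      (ρ : ℂ) * z ∈ closedBall (0 : ℂ) 1 := by
    intro ρ hρ z hz
    simp only [mem_closedBall, dist_zero_right, norm_mul, norm_real, Real.norm_eq_abs,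
      abs_of_nonneg hρ.1] at hz ⊢
    exact mul_le_one₀ hρ.2 (norm_nonneg _) hz
  have hmem' : ∀ ρ ∈ Ico (0 : ℝ) 1, ∀ z ∈ closedBall (0 : ℂ) 1, (ρ : ℂ) * z ∈ ball (0 : ℂ) 1 := by
    intro ρ hρ z hz
    simp only [mem_ball, mem_closedBall, dist_zero_right, norm_mul, norm_real, Real.norm_eq_abs,
      abs_of_nonneg hρ.1] at hz ⊢
    nlinarith [norm_nonneg z, hρ.1, hρ.2]
  have hcirc : ∀ θ : ℝ, circleMap 0 1 θ ∈ closedBall (0 : ℂ) 1 := fun θ =>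
    circleMap_mem_closedBall 0 zero_le_one θ
  -- the inequality for dilates
  have key : ∀ ρ ∈ Ico (0 : ℝ) 1, ‖G (ρ * w)‖ ^ q ≤
      Real.circleAverage (fun z => ((z + w) / (z - w)).re * ‖G (ρ * z)‖ ^ q) 0 1 := by
    intro ρ hρ
    have hd : DifferentiableOn ℂ (fun z => K (ρ * z)) (closedBall 0 1) :=
      hK.comp (by fun_prop) (hmem' ρ hρ)
    have hd' : DiffContOnCl ℂ (fun z => K (ρ * z)) (ball 0 1) := by
      apply DifferentiableOn.diffContOnCl
      rwa [closure_ball _ one_ne_zero]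
    have hP := hd'.circleAverage_re_herglotzRieszKernel_smul' hw
    simp only [sub_zero] at hP
    rw [← hKG _ (hmem' ρ hρ _ (ball_subset_closedBall hw)), ← hP]
    have := norm_nonneg w
    unfold Real.circleAverage
    rw [norm_smul, smul_eq_mul, Real.norm_of_nonneg (by positivity)]
    gcongr
    refine (intervalIntegral.norm_integral_le_integral_norm Real.two_pi_pos.le).trans (le_of_eq ?_)
    refine intervalIntegral.integral_congr fun θ _ => ?_
    simp only [norm_smul]
    rw [hKG _ (hmem' ρ hρ _ (hcirc θ)), Real.norm_of_nonneg (re_herglotz_nonneg hw (by simp))]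
  -- let the dilation parameter tend to one
  have hL : ContinuousOn (fun ρ : ℝ => ‖G (ρ * w)‖ ^ q) (Icc 0 1) := by
    refine ContinuousOn.rpow_const (ContinuousOn.norm (hGc.comp (by fun_prop) ?_))
      (fun _ _ => Or.inr hq.le)
    exact fun ρ hρ => hmem ρ hρ _ (ball_subset_closedBall hw)
  have hR : ContinuousOn (fun ρ : ℝ => Real.circleAverage
      (fun z => ((z + w) / (z - w)).re * ‖G (ρ * z)‖ ^ q) 0 1) (Icc 0 1) := by
    rw [continuousOn_iff_continuous_domRestrict]
    have hint : Continuous fun ρ : Icc (0 : ℝ) 1 => ∫ θ in (0 : ℝ)..2 * Real.pi,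
        ((circleMap 0 1 θ + w) / (circleMap 0 1 θ - w)).re *
          ‖G (((ρ : ℝ) : ℂ) * circleMap 0 1 θ)‖ ^ q := by
      refine intervalIntegral.continuous_parametric_intervalIntegral_of_continuous'
        (μ := volume) ?_ _ _
      refine Continuous.mul ?_ ?_
      · exact (continuousOn_re_herglotz hw).comp_continuous
          ((continuous_circleMap 0 1).comp continuous_snd) (by simp)
      · refine Continuous.rpow_const (Continuous.norm (hGc.comp_continuous
          ((continuous_ofReal.comp (continuous_subtype_val.comp continuous_fst)).mul
            ((continuous_circleMap 0 1).comp continuous_snd)) ?_))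
          (fun _ => Or.inr hq.le)
        rintro ⟨ρ, θ⟩
        exact hmem _ ρ.2 _ (hcirc θ)
    exact hint.const_smul (2 * Real.pi)⁻¹
  have hcl : closure (Ico (0 : ℝ) 1) = Icc 0 1 := closure_Ico zero_ne_one
  have h1 : (1 : ℝ) ∈ closure (Ico (0 : ℝ) 1) := by rw [hcl]; simp
  have := le_on_closure key (by rw [hcl]; exact hL) (by rw [hcl]; exact hR) h1
  simpa using this

/-- Finite factorization of an analytic function on the closed unit disk. -/
lemma exists_factorization {F : ℂ → ℂ} (hF : AnalyticOnNhd ℂ F (closedBall 0 1))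
    (hne : ∃ z ∈ closedBall (0 : ℂ) 1, F z ≠ 0) :
    ∃ (s : Finset ℂ) (n : ℂ → ℕ) (g : ℂ → ℂ), AnalyticOnNhd ℂ g (closedBall 0 1) ∧
      (∀ z ∈ closedBall (0 : ℂ) 1, g z ≠ 0) ∧ (∀ u ∈ s, u ∈ closedBall (0 : ℂ) 1) ∧
      ∀ z ∈ closedBall (0 : ℂ) 1, F z = (∏ u ∈ s, (z - u) ^ n u) * g z := by
  have hpc : IsPreconnected (closedBall (0 : ℂ) 1) := (convex_closedBall 0 1).isPreconnected
  have hord : ∀ u : closedBall (0 : ℂ) 1, meromorphicOrderAt F u ≠ ⊤ := by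
    intro u hu
    obtain ⟨z, hz, hFz⟩ := hne
    rw [(hF u u.2).meromorphicOrderAt_eq] at hu
    have htop : analyticOrderAt F u = ⊤ := by
      cases h : analyticOrderAt F u with
      | top => rfl
      | coe a => rw [h] at hu; simp at hu
    exact hFz (hF.eqOn_zero_of_preconnected_of_eventuallyEq_zero hpc u.2
      (analyticOrderAt_eq_top.1 htop) hz)
  set D := MeromorphicOn.divisor F (closedBall 0 1) with hDdef
  have hfin : D.support.Finite := D.finiteSupport (isCompact_closedBall 0 1)
  obtain ⟨g, hg, hg0, hFg⟩ := hF.meromorphicOn.extract_zeros_poles hord hfin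
  have hD0 : ∀ u, 0 ≤ D u := fun u => MeromorphicOn.AnalyticOnNhd.divisor_nonneg hF u
  have hprod : (∏ᶠ u, (fun z : ℂ => z - u) ^ D u) =
      fun z => ∏ u ∈ hfin.toFinset, (z - u) ^ (D u).toNat := by
    rw [finprod_eq_prod_of_mulSupport_subset (s := hfin.toFinset)]
    · ext z
      rw [Finset.prod_apply]
      refine Finset.prod_congr rfl fun u _ => ?_
      rw [Pi.pow_apply, ← zpow_natCast, Int.toNat_of_nonneg (hD0 u)]
    · intro u hu
      simp only [Function.mem_mulSupport] at hu
      simp only [Finite.coe_toFinset, Function.mem_support]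
      intro h
      exact hu (by rw [h, zpow_zero])
  refine ⟨hfin.toFinset, fun u => (D u).toNat, g, hg, fun z hz => hg0 ⟨z, hz⟩, ?_, ?_⟩
  · intro u hu
    exact D.supportWithinDomain (by simpa using hu)
  · rw [hprod] at hFg
    set P : ℂ → ℂ := fun z => (∏ u ∈ hfin.toFinset, (z - u) ^ (D u).toNat) * g z with hP
    have hPan : AnalyticOnNhd ℂ P (closedBall 0 1) := by
      intro z hz
      refine AnalyticAt.mul ?_ (hg z hz)
      exact Finset.analyticAt_fun_prod _ fun u _ => by fun_prop
    have h0 : (0 : ℂ) ∈ closedBall (0 : ℂ) 1 := by simp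
    refine hF.eqOn_of_preconnected_of_frequently_eq hPan hpc h0 ?_
    have h := (mem_codiscreteWithin_iff_forall_mem_nhdsNE.1 hFg) 0 h0
    have hnb : closedBall (0 : ℂ) 1 ∈ 𝓝[≠] (0 : ℂ) :=
      mem_nhdsWithin_of_mem_nhds (closedBall_mem_nhds 0 one_pos)
    refine Filter.Eventually.frequently ?_
    filter_upwards [h, hnb] with z hz hz'
    rcases hz with hz | hz
    · simpa [hP] using hz
    · exact absurd hz' hz

/-- **Poisson's inequality** for `‖F‖ ^ q`: this function is subharmonic for every `q > 0`. -/
lemma rpow_norm_le_poisson {F : ℂ → ℂ} (hF : AnalyticOnNhd ℂ F (closedBall 0 1)) {q : ℝ}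
    (hq : 0 < q) {w : ℂ} (hw : w ∈ ball (0 : ℂ) 1) :
    ‖F w‖ ^ q ≤ Real.circleAverage (fun z => ((z + w) / (z - w)).re * ‖F z‖ ^ q) 0 1 := by
  by_cases hne : ∃ z ∈ closedBall (0 : ℂ) 1, F z ≠ 0
  swap
  · push Not at hne
    rw [hne w (ball_subset_closedBall hw), norm_zero, Real.zero_rpow hq.ne']
    refine Real.circleAverage_nonneg_of_nonneg fun z hz => ?_
    have hz1 : ‖z‖ = 1 := by simpa using hz
    exact mul_nonneg (re_herglotz_nonneg hw hz1) (by positivity)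
  obtain ⟨s, n, g, hg, hg0, hs, hFg⟩ := exists_factorization hF hne
  set G : ℂ → ℂ := fun z => (∏ u ∈ s, (1 - (starRingEnd ℂ) u * z) ^ n u) * g z with hG
  have hGd : DifferentiableOn ℂ G (closedBall 0 1) := by
    refine DifferentiableOn.mul ?_ hg.differentiableOn
    exact DifferentiableOn.fun_finsetProd fun u _ => by fun_prop
  have hG0 : ∀ z ∈ ball (0 : ℂ) 1, G z ≠ 0 := by
    intro z hz
    refine mul_ne_zero (Finset.prod_ne_zero_iff.2 fun u hu => pow_ne_zero _ ?_)
      (hg0 z (ball_subset_closedBall hz))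
    intro h
    have h1 : ‖(starRingEnd ℂ) u * z‖ = 1 := by rw [← sub_eq_zero.1 h]; simp
    have h2 : ‖u‖ ≤ 1 := by simpa using hs u hu
    have h3 : ‖z‖ < 1 := by simpa using hz
    rw [norm_mul, RCLike.norm_conj] at h1
    nlinarith [norm_nonneg u, norm_nonneg z]
  have hsq : ∀ u z : ℂ, ‖1 - (starRingEnd ℂ) u * z‖ ^ 2 - ‖z - u‖ ^ 2 =
      (1 - ‖u‖ ^ 2) * (1 - ‖z‖ ^ 2) := by
    intro u z
    simp only [← normSq_eq_norm_sq, normSq_apply]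
    simp
    ring
  have hle : ‖F w‖ ≤ ‖G w‖ := by
    rw [hFg w (ball_subset_closedBall hw), hG, norm_mul, norm_mul, norm_prod, norm_prod]
    refine mul_le_mul_of_nonneg_right (Finset.prod_le_prod (fun _ _ => norm_nonneg _)
      fun u hu => ?_) (norm_nonneg _)
    rw [norm_pow, norm_pow]
    refine pow_le_pow_left₀ (norm_nonneg _) ?_ _
    have h2 : ‖u‖ ≤ 1 := by simpa using hs u hu
    have h3 : ‖w‖ < 1 := by simpa using hw
    refine abs_le_of_sq_le_sq' ?_ (norm_nonneg _) |>.2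
    have := hsq u w
    have h4 : 0 ≤ (1 - ‖u‖ ^ 2) * (1 - ‖w‖ ^ 2) := by
      refine mul_nonneg ?_ ?_ <;> nlinarith [norm_nonneg u, norm_nonneg w]
    linarith
  have heq : ∀ z ∈ sphere (0 : ℂ) |1|, ‖F z‖ = ‖G z‖ := by
    intro z hz
    have hz1 : ‖z‖ = 1 := by simpa using hz
    rw [hFg z (by simp [hz1]), hG, norm_mul, norm_mul, norm_prod, norm_prod]
    congr 1
    refine Finset.prod_congr rfl fun u _ => ?_
    rw [norm_pow, norm_pow]
    congr 1
    have := hsq u z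
    rw [hz1] at this
    refine (sq_eq_sq₀ (norm_nonneg _) (norm_nonneg _)).1 ?_
    linarith
  calc ‖F w‖ ^ q ≤ ‖G w‖ ^ q := Real.rpow_le_rpow (norm_nonneg _) hle hq.le
    _ ≤ _ := rpow_norm_le_poisson_of_ne_zero (hGd.mono ball_subset_closedBall) hGd.continuousOn
        hG0 hq hw
    _ = _ := Real.circleAverage_congr_sphere fun z hz => by
        simp only [heq z hz]

lemma norm_circleAverage_le {u : ℂ → ℂ} {c : ℂ} {r : ℝ} :
    ‖Real.circleAverage u c r‖ ≤ Real.circleAverage (fun z => ‖u z‖) c r := by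
  unfold Real.circleAverage
  rw [norm_smul, smul_eq_mul, Real.norm_of_nonneg (by positivity)]
  gcongr
  exact intervalIntegral.norm_integral_le_integral_norm Real.two_pi_pos.le

/-- Parseval's identity on the unit circle. -/
lemma hasSum_sq_circleAverage {g : ℂ → ℂ} (hg : ContinuousOn g (sphere 0 1)) :
    HasSum (fun n : ℤ => ‖Real.circleAverage (fun z => z ^ (-n) * g z) 0 1‖ ^ 2)
      (Real.circleAverage (fun z => ‖g z‖ ^ 2) 0 1) := by
  have hab : (0 : ℝ) < 2 * Real.pi := Real.two_pi_pos
  have hc : Continuous fun θ : ℝ => g (circleMap 0 1 θ) :=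
    hg.comp_continuous (continuous_circleMap 0 1) (by simp)
  have hL2 : MemLp (fun θ : ℝ => g (circleMap 0 1 θ)) 2
      (volume.restrict (Ioc 0 (2 * Real.pi))) := by
    obtain ⟨C, hC⟩ := isCompact_Icc.exists_bound_of_continuousOn
      (hc.continuousOn (s := Icc 0 (2 * Real.pi)))
    refine MemLp.of_bound hc.aestronglyMeasurable C ?_
    exact (ae_restrict_mem measurableSet_Ioc).mono fun θ hθ => hC θ (Ioc_subset_Icc_self hθ)
  have h := hasSum_sq_fourierCoeffOn hab hL2
  have hcoe : ∀ n : ℤ, fourierCoeffOn hab (fun θ : ℝ => g (circleMap 0 1 θ)) n =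
      Real.circleAverage (fun z => z ^ (-n) * g z) 0 1 := by
    intro n
    rw [fourierCoeffOn_eq_integral, Real.circleAverage, sub_zero, one_div]
    congr 1
    refine intervalIntegral.integral_congr fun θ _ => ?_
    have hπ : (Real.pi : ℂ) ≠ 0 := by exact_mod_cast Real.pi_ne_zero
    simp only [fourier_coe_apply, smul_eq_mul, circleMap_zero, ofReal_one, one_mul]
    rw [← exp_int_mul]
    congr 2
    push_cast
    field_simp
  simp only [hcoe] at h
  simpa [Real.circleAverage] using h

/-- The Taylor coefficients at the origin. -/
noncomputable def taylorCoeff (F : ℂ → ℂ) (n : ℕ) : ℂ := ((n.factorial : ℂ))⁻¹ * iteratedDeriv n F 0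

lemma circleAverage_zpow_mul {F : ℂ → ℂ} (hF : DifferentiableOn ℂ F (ball 0 1)) {r : ℝ}
    (hr : r ∈ Ioo (0 : ℝ) 1) (n : ℕ) :
    Real.circleAverage (fun z => z ^ (-(n : ℤ)) * F z) 0 r = taylorCoeff F n := by
  have hd : DiffContOnCl ℂ F (ball 0 r) := by
    apply DifferentiableOn.diffContOnCl
    rw [closure_ball _ hr.1.ne']
    exact hF.mono (closedBall_subset_ball hr.2)
  have h := hd.circleIntegral_one_div_sub_center_pow_smul hr.1 n
  rw [Real.circleAverage_eq_circleIntegral hr.1.ne', taylorCoeff]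
  have h2 : (∮ z in C(0, r), (z - 0)⁻¹ • (z ^ (-(n : ℤ)) * F z)) =
      ∮ z in C(0, r), (1 / (z - 0) ^ (n + 1)) • F z := by
    refine circleIntegral.integral_congr hr.1.le fun z hz => ?_
    simp only [smul_eq_mul, sub_zero, zpow_neg, zpow_natCast, one_div, pow_succ, mul_inv]
    ring
  rw [h2, h, smul_eq_mul, smul_eq_mul]
  have := two_pi_I_ne_zero
  field_simp

/-- Parseval's identity for the Taylor coefficients of an analytic function. -/
lemma hasSum_sq_taylorCoeff {F : ℂ → ℂ} (hF : DifferentiableOn ℂ F (ball 0 1)) {r : ℝ}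
    (hr : r ∈ Ioo (0 : ℝ) 1) :
    HasSum (fun n : ℕ => (‖taylorCoeff F n‖ * r ^ n) ^ 2)
      (Real.circleAverage (fun z => ‖F z‖ ^ 2) 0 r) := by
  have hmaps : MapsTo (fun z : ℂ => (r : ℂ) * z) (closedBall 0 1) (ball 0 1) := by
    intro z hz
    simp only [mem_ball, mem_closedBall, dist_zero_right, norm_mul, norm_real, Real.norm_eq_abs,
      abs_of_pos hr.1] at hz ⊢
    nlinarith [norm_nonneg z, hr.1, hr.2]
  have hgd : DifferentiableOn ℂ (fun z => F (r * z)) (closedBall 0 1) :=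
    hF.comp (by fun_prop) hmaps
  have h := hasSum_sq_circleAverage (hgd.continuousOn.mono sphere_subset_closedBall)
  have hsq : Real.circleAverage (fun z => ‖F (r * z)‖ ^ 2) 0 1 =
      Real.circleAverage (fun z => ‖F z‖ ^ 2) 0 r := by
    rw [Real.circleAverage_eq_circleAverage_zero_one (R := r)]
    simp
  have hpos : ∀ n : ℕ, Real.circleAverage (fun z => z ^ (-(n : ℤ)) * F (r * z)) 0 1 =
      (r : ℂ) ^ n * taylorCoeff F n := by
    intro n
    have hr0 : (r : ℂ) ≠ 0 := by exact_mod_cast hr.1.ne'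
    rw [← circleAverage_zpow_mul hF hr n, Real.circleAverage_eq_circleAverage_zero_one (R := r)]
    simp only [add_zero]
    rw [← smul_eq_mul, ← Real.circleAverage_fun_smul]
    congr 1
    ext z
    simp only [smul_eq_mul, zpow_neg, zpow_natCast, mul_pow, mul_inv]
    field_simp
  have hneg : ∀ n : ℤ, n ∉ range ((↑) : ℕ → ℤ) →
      ‖Real.circleAverage (fun z => z ^ (-n) * F (r * z)) 0 1‖ ^ 2 = 0 := by
    intro n hn
    obtain ⟨k, hk, rfl⟩ : ∃ k : ℕ, k ≠ 0 ∧ n = -(k : ℤ) := by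
      have hn0 : n < 0 := by
        by_contra h0
        exact hn ⟨n.toNat, by simp at h0 ⊢; exact h0⟩
      exact ⟨n.natAbs, by omega, by omega⟩
    have hd : DiffContOnCl ℂ (fun z : ℂ => z ^ k * F (r * z)) (ball 0 1) := by
      apply DifferentiableOn.diffContOnCl
      rw [closure_ball _ one_ne_zero]
      exact DifferentiableOn.mul (by fun_prop) hgd
    have := DiffContOnCl.circleAverage (R := 1) (c := 0) (by simpa using hd)
    simp only [neg_neg, zpow_natCast]
    rw [this]
    simp [hk]
  rw [hsq] at h
  rw [← (Nat.cast_injective (R := ℤ)).hasSum_iff hneg] at h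
  convert h using 1
  ext n
  rw [Function.comp_apply, hpos, norm_mul, norm_pow, norm_real, Real.norm_of_nonneg hr.1.le,
    mul_comm]

lemma hardyMeanP_eq_circleAverage (p : ℝ) (f : ℂ → ℂ) (r : ℝ) :
    hardyMeanP p f r = Real.circleAverage (fun z => ‖f z‖ ^ p) 0 r := by
  simp [hardyMeanP, Real.circleAverage, circleMap]

/-- The sum of the power series with the given coefficients. -/
noncomputable def powerSum (a : ℕ → ℂ) (z : ℂ) : ℂ := ∑' n, a n * z ^ n

lemma hasSum_powerSum {a : ℕ → ℂ} {K : ℝ} (ha : ∀ n, ‖a n‖ ≤ K) {z : ℂ}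
    (hz : z ∈ ball (0 : ℂ) 1) : HasSum (fun n => a n * z ^ n) (powerSum a z) := by
  have hz' : ‖z‖ < 1 := by simpa using hz
  refine Summable.hasSum (Summable.of_norm_bounded
    ((summable_geometric_of_lt_one (norm_nonneg z) hz').mul_left K) fun n => ?_)
  rw [norm_mul, norm_pow]
  gcongr
  exact ha n

lemma hasFPowerSeriesOnBall_powerSum {a : ℕ → ℂ} {K : ℝ} (ha : ∀ n, ‖a n‖ ≤ K) :
    HasFPowerSeriesOnBall (powerSum a) (FormalMultilinearSeries.ofScalars ℂ a) 0 1 where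
  r_le := by
    have h := (FormalMultilinearSeries.ofScalars ℂ a).le_radius_of_bound (r := 1) K
      (fun n => by simpa [FormalMultilinearSeries.ofScalars_norm] using ha n)
    simpa using h
  r_pos := one_pos
  hasSum := by
    intro y hy
    have hy1 : ‖y‖₊ < 1 := by
      simpa [Metric.mem_eball, edist_zero_right, enorm_eq_nnnorm] using hy
    have hy' : y ∈ ball (0 : ℂ) 1 := mem_ball_zero_iff.2 (by exact_mod_cast hy1)
    simpa [FormalMultilinearSeries.ofScalars_apply_eq, mul_comm] using hasSum_powerSum ha hy'

lemma differentiableOn_powerSum {a : ℕ → ℂ} {K : ℝ} (ha : ∀ n, ‖a n‖ ≤ K) :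
    DifferentiableOn ℂ (powerSum a) (ball 0 1) := by
  have := (hasFPowerSeriesOnBall_powerSum ha).differentiableOn
  refine this.mono fun z hz => ?_
  have hz1 : ‖z‖₊ < 1 := by exact_mod_cast mem_ball_zero_iff.1 hz
  simpa [Metric.mem_eball, edist_zero_right, enorm_eq_nnnorm] using hz1

lemma taylorCoeff_powerSum {a : ℕ → ℂ} {K : ℝ} (ha : ∀ n, ‖a n‖ ≤ K) (n : ℕ) :
    taylorCoeff (powerSum a) n = a n := by
  have h := (hasFPowerSeriesOnBall_powerSum ha).factorial_smul 1 n
  rw [iteratedFDeriv_apply_eq_iteratedDeriv_mul_prod, Finset.prod_const_one, one_smul] at h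
  have hn : (n.factorial : ℂ) ≠ 0 := by exact_mod_cast n.factorial_ne_zero
  rw [taylorCoeff, ← h]
  simp [hn]

lemma hasSum_taylorCoeff {F : ℂ → ℂ} (hF : DifferentiableOn ℂ F (ball 0 1)) {z : ℂ}
    (hz : z ∈ ball (0 : ℂ) 1) : HasSum (fun n => taylorCoeff F n * z ^ n) (F z) := by
  have h := hasSum_taylorSeries_on_ball (c := 0) (r := 1) (by simpa using hF) (by simpa using hz)
  have e : ∀ n : ℕ, taylorCoeff F n * z ^ n =
      (n.factorial : ℂ)⁻¹ • (z - 0) ^ n • iteratedDeriv n F 0 := fun n => by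
    rw [taylorCoeff, sub_zero, smul_eq_mul, smul_eq_mul]
    ring
  simp only [e]
  exact h

lemma powerSum_taylorCoeff {F : ℂ → ℂ} (hF : DifferentiableOn ℂ F (ball 0 1)) {z : ℂ}
    (hz : z ∈ ball (0 : ℂ) 1) : powerSum (taylorCoeff F) z = F z :=
  (hasSum_taylorCoeff hF hz).tsum_eq

lemma circleAverage_sq_powerSum_le {a : ℕ → ℂ} (ha : Summable fun n => ‖a n‖ ^ 2) {r : ℝ}
    (hr : r ∈ Ioo (0 : ℝ) 1) :
    Real.circleAverage (fun z => ‖powerSum a z‖ ^ 2) 0 r ≤ ∑' n, ‖a n‖ ^ 2 := by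
  have hb : ∀ n, ‖a n‖ ≤ √(∑' n, ‖a n‖ ^ 2) := fun n =>
    Real.le_sqrt_of_sq_le (ha.le_tsum n fun _ _ => by positivity)
  have h := hasSum_sq_taylorCoeff (differentiableOn_powerSum hb) hr
  simp only [taylorCoeff_powerSum hb] at h
  refine hasSum_le (fun n => ?_) h ha.hasSum
  have := pow_le_one₀ (n := n) hr.1.le hr.2.le
  have := pow_nonneg hr.1.le n
  gcongr
  nlinarith [norm_nonneg (a n)]

lemma sum_sq_taylorCoeff_le {F : ℂ → ℂ} (hF : DifferentiableOn ℂ F (ball 0 1)) {B : ℝ}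
    (hB : ∀ r ∈ Ioo (0 : ℝ) 1, Real.circleAverage (fun z => ‖F z‖ ^ 2) 0 r ≤ B)
    (s : Finset ℕ) : ∑ n ∈ s, ‖taylorCoeff F n‖ ^ 2 ≤ B := by
  have h1 : ∀ r ∈ Ioo (0 : ℝ) 1, ∑ n ∈ s, (‖taylorCoeff F n‖ * r ^ n) ^ 2 ≤ B := fun r hr =>
    (sum_le_hasSum s (fun _ _ => by positivity) (hasSum_sq_taylorCoeff hF hr)).trans (hB r hr)
  have hcl : closure (Ioo (0 : ℝ) 1) = Icc 0 1 := closure_Ioo zero_ne_one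
  have := le_on_closure h1 (Continuous.continuousOn (by fun_prop)) continuousOn_const
    (x := 1) (by rw [hcl]; simp)
  simpa using this

lemma summable_sq_taylorCoeff {F : ℂ → ℂ} (hF : DifferentiableOn ℂ F (ball 0 1)) {B : ℝ}
    (hB : ∀ r ∈ Ioo (0 : ℝ) 1, Real.circleAverage (fun z => ‖F z‖ ^ 2) 0 r ≤ B) :
    Summable fun n => ‖taylorCoeff F n‖ ^ 2 :=
  summable_of_sum_le (fun _ => by positivity) (sum_sq_taylorCoeff_le hF hB)

/-- The Poisson integral of a real function on the circle is the real part of a power series. -/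
lemma poisson_eq_re_powerSum {u : ℂ → ℝ} (hu : ContinuousOn u (sphere 0 1)) {w : ℂ}
    (hw : w ∈ ball (0 : ℂ) 1) :
    Real.circleAverage (fun z => ((z + w) / (z - w)).re * u z) 0 1 =
      (powerSum (fun k => (if k = 0 then 1 else 2) *
        Real.circleAverage (fun z => z ^ (-(k : ℤ)) * (u z : ℂ)) 0 1) w).re := by
  have hw' : ‖w‖ < 1 := by simpa using hw
  set e : ℕ → ℂ := fun k => if k = 0 then 1 else 2 with he
  have hen : ∀ k, ‖e k‖ ≤ 2 := fun k => by
    simp only [he]; split_ifs <;> norm_num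
  have huc : Continuous fun θ : ℝ => u (circleMap 0 1 θ) :=
    hu.comp_continuous (continuous_circleMap 0 1) (by simp)
  obtain ⟨U, hU⟩ := (isCompact_sphere (0 : ℂ) 1).exists_bound_of_continuousOn hu
  have hexp : ∀ z : ℂ, ‖z‖ = 1 →
      HasSum (fun k => e k * w ^ k * (z ^ (-(k : ℤ)) * (u z : ℂ))) ((z + w) / (z - w) * u z) := by
    intro z hz
    have hz0 : z ≠ 0 := by rintro rfl; simp at hz
    have hzw : z - w ≠ 0 := by
      intro h; rw [sub_eq_zero] at h; rw [h] at hz; linarith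
    have hq : ‖w / z‖ < 1 := by rw [norm_div, hz, div_one]; exact hw'
    have h1 := ((hasSum_geometric_of_norm_lt_one hq).mul_left 2).sub (hasSum_ite_eq 0 (1 : ℂ))
    have h2 := h1.mul_right (u z : ℂ)
    have e1 : ∀ k : ℕ, e k * w ^ k * (z ^ (-(k : ℤ)) * (u z : ℂ)) =
        (2 * (w / z) ^ k - if k = 0 then 1 else 0) * (u z : ℂ) := by
      intro k
      rcases eq_or_ne k 0 with rfl | hk
      · simp only [he, if_true, pow_zero, Nat.cast_zero, neg_zero, zpow_zero]
        ring
      · simp only [he, hk, if_false, zpow_neg, zpow_natCast, div_pow]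
        field_simp
        ring
    have e2 : (z + w) / (z - w) * (u z : ℂ) = (2 * (1 - w / z)⁻¹ - 1) * (u z : ℂ) := by
      have : (1 - w / z)⁻¹ = z / (z - w) := by
        rw [one_sub_div hz0, inv_div]
      rw [this]
      congr 1
      field_simp
      ring
    simp only [e1]
    rw [e2]
    exact h2
  have hsum : HasSum (fun k => Real.circleAverage
      (fun z => e k * w ^ k * (z ^ (-(k : ℤ)) * (u z : ℂ))) 0 1)
      (Real.circleAverage (fun z => (z + w) / (z - w) * u z) 0 1) := by
    unfold Real.circleAverage
    refine HasSum.const_smul _ ?_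
    refine intervalIntegral.hasSum_integral_of_dominated_convergence
      (fun k _ => 2 * ‖w‖ ^ k * U) (fun k => ?_) (fun k => ?_) ?_ ?_ ?_
    · have : Continuous fun θ : ℝ => (circleMap 0 1 θ) ^ (-(k : ℤ)) :=
        (continuous_circleMap 0 1).zpow₀ _ fun θ => Or.inl (circleMap_ne_center one_ne_zero)
      exact (continuous_const.mul (this.mul (continuous_ofReal.comp huc))).aestronglyMeasurable
    · refine Eventually.of_forall fun θ _ => ?_
      have hUθ := hU (circleMap 0 1 θ) (by simp)
      rw [norm_mul, norm_mul, norm_mul, norm_zpow, norm_pow, norm_real]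
      simp only [norm_circleMap_zero, abs_one, one_zpow, one_mul]
      gcongr
      exact hen k
    · refine Eventually.of_forall fun θ _ => ?_
      exact ((summable_geometric_of_lt_one (norm_nonneg w) hw').mul_left 2).mul_right U
    · exact intervalIntegrable_const
    · exact Eventually.of_forall fun θ _ => hexp _ (by simp)
  have hterm : ∀ k, Real.circleAverage (fun z => e k * w ^ k * (z ^ (-(k : ℤ)) * (u z : ℂ))) 0 1 =
      e k * Real.circleAverage (fun z => z ^ (-(k : ℤ)) * (u z : ℂ)) 0 1 * w ^ k := by
    intro k
    simp only [← smul_eq_mul (e k * w ^ k)]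
    rw [Real.circleAverage_fun_smul, smul_eq_mul]
    ring
  have hci : CircleIntegrable (fun z => (z + w) / (z - w) * (u z : ℂ)) 0 1 := by
    refine ContinuousOn.circleIntegrable zero_le_one ?_
    refine ContinuousOn.mul (ContinuousOn.div (by fun_prop) (by fun_prop) fun z hz h => ?_)
      (continuous_ofReal.comp_continuousOn hu)
    rw [sub_eq_zero] at h
    simp only [mem_sphere, dist_zero_right, h] at hz
    linarith
  have hre := reCLM.circleAverage_comp_comm hci
  have hpow : powerSum (fun k => e k *
      Real.circleAverage (fun z => z ^ (-(k : ℤ)) * (u z : ℂ)) 0 1) w =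
      Real.circleAverage (fun z => (z + w) / (z - w) * u z) 0 1 := by
    rw [← hsum.tsum_eq]
    exact tsum_congr fun k => (hterm k).symm
  rw [hpow, ← reCLM_apply, ← hre]
  congr 1
  ext z
  simp [Function.comp_apply]

lemma continuousOn_rpow_norm_dilate {f : ℂ → ℂ} (hf : DifferentiableOn ℂ f (ball 0 1)) {q : ℝ}
    (hq : 0 < q) {R : ℝ} (hR : R ∈ Ioo (0 : ℝ) 1) :
    ContinuousOn (fun z : ℂ => ‖f (R * z)‖ ^ q) (sphere 0 1) := by
  refine ContinuousOn.rpow_const (ContinuousOn.norm (hf.continuousOn.comp (by fun_prop) ?_))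
    (fun _ _ => Or.inr hq.le)
  intro z hz
  have hz1 : ‖z‖ = 1 := by simpa using hz
  simp [hz1, abs_of_pos hR.1, hR.2]

lemma circleAverage_rpow_norm_dilate (f : ℂ → ℂ) (q R : ℝ) :
    Real.circleAverage (fun z : ℂ => ‖f (R * z)‖ ^ q) 0 1 =
      Real.circleAverage (fun z => ‖f z‖ ^ q) 0 R := by
  rw [Real.circleAverage_eq_circleAverage_zero_one (R := R)]
  simp

/-- An analytic function whose `q`-means are bounded satisfies `‖f‖ ^ q ≤ Re h` for an analytic
function `h`, with control on the coefficients of `h`. -/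
theorem exists_harmonic_majorant {f : ℂ → ℂ} (hf : DifferentiableOn ℂ f (ball 0 1)) {q : ℝ}
    (hq : 0 < q) {A : ℝ}
    (hA : ∀ r ∈ Ioo (0 : ℝ) 1, Real.circleAverage (fun z => ‖f z‖ ^ q) 0 r ≤ A) :
    ∃ d : ℕ → ℂ, (∀ k, ‖d k‖ ≤ 2 * A) ∧
      (∀ B, (∀ r ∈ Ioo (0 : ℝ) 1, Real.circleAverage (fun z => ‖f z‖ ^ (2 * q)) 0 r ≤ B) →
        ∀ s : Finset ℕ, ∑ k ∈ s, ‖d k‖ ^ 2 ≤ 4 * B) ∧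
      ∀ w ∈ ball (0 : ℂ) 1, ‖f w‖ ^ q ≤ (powerSum d w).re := by
  set c : ℝ → ℕ → ℂ := fun R k =>
    Real.circleAverage (fun z => z ^ (-(k : ℤ)) * ((‖f (R * z)‖ ^ q : ℝ) : ℂ)) 0 1 with hc
  set e : ℕ → ℂ := fun k => if k = 0 then 1 else 2 with he
  have hen : ∀ k, ‖e k‖ ≤ 2 := fun k => by
    simp only [he]; split_ifs <;> norm_num
  have hcA : ∀ R ∈ Ioo (0 : ℝ) 1, ∀ k, ‖e k * c R k‖ ≤ 2 * A := by
    intro R hR k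
    rw [norm_mul]
    have h1 : ‖c R k‖ ≤ A := by
      refine norm_circleAverage_le.trans (le_trans (le_of_eq ?_) (hA R hR))
      rw [← circleAverage_rpow_norm_dilate]
      refine Real.circleAverage_congr_sphere fun z hz => ?_
      have hz1 : ‖z‖ = 1 := by simpa using hz
      simp only [norm_mul, norm_zpow, hz1, one_zpow, one_mul, norm_real]
      rw [Real.norm_of_nonneg (by positivity)]
    exact mul_le_mul (hen k) h1 (norm_nonneg _) zero_le_two
  set l : Filter ℝ := 𝓝[<] 1
  set 𝒰 : Ultrafilter ℝ := Ultrafilter.of l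
  have hmem : ∀ᶠ R in (𝒰 : Filter ℝ), R ∈ Ioo (0 : ℝ) 1 :=
    Ultrafilter.of_le l (Ioo_mem_nhdsLT zero_lt_one)
  have hlim : ∀ k, ∃ d : ℂ, ‖d‖ ≤ 2 * A ∧ Tendsto (fun R => e k * c R k) 𝒰 (𝓝 d) := by
    intro k
    have hcomp := isCompact_closedBall (0 : ℂ) (2 * A)
    obtain ⟨d, hd, hle⟩ := hcomp.ultrafilter_le_nhds (𝒰.map fun R => e k * c R k) (by
      rw [le_principal_iff]
      refine hmem.mono fun R hR => ?_
      simpa using hcA R hR k)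
    exact ⟨d, by simpa using hd, hle⟩
  choose d hdA hdlim using hlim
  refine ⟨d, hdA, ?_, ?_⟩
  · intro B hB s
    have hsum : Tendsto (fun R => ∑ k ∈ s, ‖e k * c R k‖ ^ 2) 𝒰 (𝓝 (∑ k ∈ s, ‖d k‖ ^ 2)) :=
      tendsto_finsetSum _ fun k _ => (hdlim k).norm.pow 2
    refine le_of_tendsto hsum (hmem.mono fun R hR => ?_)
    have hP := hasSum_sq_circleAverage
      (continuous_ofReal.comp_continuousOn (continuousOn_rpow_norm_dilate hf hq hR))
    have hle := sum_le_hasSum (s.map ⟨((↑) : ℕ → ℤ), Nat.cast_injective⟩)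
      (fun _ _ => by positivity) hP
    rw [Finset.sum_map] at hle
    have hrhs : Real.circleAverage (fun z =>
        ‖(ofReal ∘ fun z : ℂ => ‖f (R * z)‖ ^ q) z‖ ^ 2) 0 1 ≤ B := by
      refine le_trans (le_of_eq ?_) (hB R hR)
      rw [← circleAverage_rpow_norm_dilate]
      congr 1
      ext z
      simp only [Function.comp_apply, norm_real]
      rw [Real.norm_of_nonneg (by positivity), mul_comm 2 q, Real.rpow_mul (norm_nonneg _),
        Real.rpow_two]
    calc ∑ k ∈ s, ‖e k * c R k‖ ^ 2 ≤ ∑ k ∈ s, 4 * ‖c R k‖ ^ 2 := by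
          refine Finset.sum_le_sum fun k _ => ?_
          rw [norm_mul, mul_pow]
          have := hen k
          gcongr
          nlinarith [norm_nonneg (e k)]
      _ = 4 * ∑ k ∈ s, ‖c R k‖ ^ 2 := (Finset.mul_sum ..).symm
      _ ≤ 4 * B := by
          gcongr
          exact hle.trans hrhs
  · intro w hw
    have hw' : ‖w‖ < 1 := by simpa using hw
    have h1 : Tendsto (fun R => (powerSum (fun k => e k * c R k) w).re) 𝒰
        (𝓝 (powerSum d w).re) := by
      refine (continuous_re.tendsto _).comp ?_
      refine tendsto_tsum_of_dominated_convergence (bound := fun k => 2 * A * ‖w‖ ^ k)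
        ((summable_geometric_of_lt_one (norm_nonneg w) hw').mul_left _)
        (fun k => (hdlim k).mul_const _) (hmem.mono fun R hR k => ?_)
      rw [norm_mul, norm_pow]
      gcongr
      exact hcA R hR k
    have h2 : Tendsto (fun R : ℝ => ‖f (R * w)‖ ^ q) 𝒰 (𝓝 (‖f w‖ ^ q)) := by
      have hfc : ContinuousAt f ((1 : ℝ) * w) := by
        rw [ofReal_one, one_mul]
        exact (hf.differentiableAt (isOpen_ball.mem_nhds hw)).continuousAt
      have h3 : ContinuousAt (fun R : ℝ => ‖f (R * w)‖ ^ q) 1 := by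
        refine ContinuousAt.rpow_const (ContinuousAt.norm ?_) (Or.inr hq.le)
        exact ContinuousAt.comp (f := fun R : ℝ => (R : ℂ) * w) hfc (by fun_prop)
      have h4 := h3.tendsto
      simp only [ofReal_one, one_mul] at h4
      exact h4.mono_left ((Ultrafilter.of_le l).trans nhdsWithin_le_nhds)
    refine le_of_tendsto_of_tendsto h2 h1 (hmem.mono fun R hR => ?_)
    have hF : AnalyticOnNhd ℂ (fun z => f (R * z)) (closedBall 0 1) := by
      have hdo : DifferentiableOn ℂ (fun z => f (R * z)) (ball 0 R⁻¹) := by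
        refine hf.comp (by fun_prop) fun z hz => ?_
        simp only [mem_ball, dist_zero_right, norm_mul, norm_real, Real.norm_eq_abs,
          abs_of_pos hR.1] at hz ⊢
        have := mul_lt_mul_of_pos_left hz hR.1
        rwa [mul_inv_cancel₀ hR.1.ne'] at this
      exact (hdo.analyticOnNhd isOpen_ball).mono
        (closedBall_subset_ball ((one_lt_inv₀ hR.1).2 hR.2))
    have h5 := rpow_norm_le_poisson hF hq hw
    have h6 := poisson_eq_re_powerSum (continuousOn_rpow_norm_dilate hf hq hR) hw
    exact h5.trans_eq h6

lemma sphere_subset_unit_ball {r : ℝ} (hr : r ∈ Ioo (0 : ℝ) 1) :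
    sphere (0 : ℂ) |r| ⊆ ball 0 1 := by
  rw [abs_of_pos hr.1]
  exact sphere_subset_closedBall.trans (closedBall_subset_ball hr.2)

lemma circleIntegrable_of_continuousOn_ball {E : Type*} [NormedAddCommGroup E] {u : ℂ → E}
    (hu : ContinuousOn u (ball 0 1)) {r : ℝ} (hr : r ∈ Ioo (0 : ℝ) 1) : CircleIntegrable u 0 r :=
  (hu.mono (by simpa [abs_of_pos hr.1] using sphere_subset_unit_ball hr)).circleIntegrable hr.1.le

lemma circleAverage_le_of_le_on_ball {u v : ℂ → ℝ} (hu : ContinuousOn u (ball 0 1))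
    (hv : ContinuousOn v (ball 0 1)) (huv : ∀ z ∈ ball (0 : ℂ) 1, u z ≤ v z) {r : ℝ}
    (hr : r ∈ Ioo (0 : ℝ) 1) : Real.circleAverage u 0 r ≤ Real.circleAverage v 0 r :=
  Real.circleAverage_mono (circleIntegrable_of_continuousOn_ball hu hr)
    (circleIntegrable_of_continuousOn_ball hv hr)
    fun z hz => huv z (sphere_subset_unit_ball hr hz)

lemma continuousOn_rpow_norm {f : ℂ → ℂ} {s : Set ℂ} (hf : ContinuousOn f s) {q : ℝ}
    (hq : 0 < q) : ContinuousOn (fun z => ‖f z‖ ^ q) s :=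
  hf.norm.rpow_const fun _ _ => Or.inr hq.le

lemma circleAverage_re_of_differentiableOn {F : ℂ → ℂ} (hF : DifferentiableOn ℂ F (ball 0 1))
    {r : ℝ} (hr : r ∈ Ioo (0 : ℝ) 1) :
    Real.circleAverage (fun z => (F z).re) 0 r = (F 0).re := by
  have h := reCLM.circleAverage_comp_comm
    (circleIntegrable_of_continuousOn_ball hF.continuousOn hr)
  have hd : DiffContOnCl ℂ F (ball 0 |r|) := by
    apply DifferentiableOn.diffContOnCl
    rw [abs_of_pos hr.1, closure_ball _ hr.1.ne']
    exact hF.mono (closedBall_subset_ball hr.2)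
  rw [hd.circleAverage] at h
  simpa [Function.comp_def] using h

lemma norm_powerSum_le {a : ℕ → ℂ} {K : ℝ} (ha : ∀ n, ‖a n‖ ≤ K) {z : ℂ}
    (hz : z ∈ ball (0 : ℂ) 1) : ‖powerSum a z‖ ≤ K / (1 - ‖z‖) := by
  have hz' : ‖z‖ < 1 := by simpa using hz
  rw [div_eq_mul_inv]
  refine tsum_of_norm_bounded ((hasSum_geometric_of_lt_one (norm_nonneg z) hz').mul_left K)
    fun n => ?_
  rw [norm_mul, norm_pow]
  gcongr
  exact ha n

/-- **Littlewood's subordination principle**, with an explicit constant. -/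
theorem circleAverage_comp_le {f : ℂ → ℂ} (hf : DifferentiableOn ℂ f (ball 0 1)) {q : ℝ}
    (hq : 0 < q) {A : ℝ}
    (hA : ∀ r ∈ Ioo (0 : ℝ) 1, Real.circleAverage (fun z => ‖f z‖ ^ q) 0 r ≤ A)
    {ψ : ℂ → ℂ} (hψ : DifferentiableOn ℂ ψ (ball 0 1)) (hψm : MapsTo ψ (ball 0 1) (ball 0 1))
    {r : ℝ} (hr : r ∈ Ioo (0 : ℝ) 1) :
    Real.circleAverage (fun z => ‖f (ψ z)‖ ^ q) 0 r ≤ 2 * A / (1 - ‖ψ 0‖) := by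
  obtain ⟨d, hd, -, hfd⟩ := exists_harmonic_majorant hf hq hA
  have hP : DifferentiableOn ℂ (fun z => powerSum d (ψ z)) (ball 0 1) :=
    (differentiableOn_powerSum hd).comp hψ hψm
  calc Real.circleAverage (fun z => ‖f (ψ z)‖ ^ q) 0 r
      ≤ Real.circleAverage (fun z => (powerSum d (ψ z)).re) 0 r :=
        circleAverage_le_of_le_on_ball
          (continuousOn_rpow_norm (hf.continuousOn.comp hψ.continuousOn hψm) hq)
          (continuous_re.comp_continuousOn hP.continuousOn) (fun z hz => hfd _ (hψm hz)) hr
    _ = (powerSum d (ψ 0)).re := circleAverage_re_of_differentiableOn hP hr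
    _ ≤ ‖powerSum d (ψ 0)‖ := re_le_norm _
    _ ≤ _ := norm_powerSum_le hd (hψm (mem_ball_self one_pos))

lemma circleAverage_const_mul_add {u v : ℂ → ℝ} (hu : ContinuousOn u (ball 0 1))
    (hv : ContinuousOn v (ball 0 1)) (a b : ℝ) {r : ℝ} (hr : r ∈ Ioo (0 : ℝ) 1) :
    Real.circleAverage (fun z => a * u z + b * v z) 0 r =
      a * Real.circleAverage u 0 r + b * Real.circleAverage v 0 r := by
  rw [Real.circleAverage_fun_add (f₁ := fun z => a * u z) (f₂ := fun z => b * v z)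
    (circleIntegrable_of_continuousOn_ball (continuousOn_const.mul hu) hr)
    (circleIntegrable_of_continuousOn_ball (continuousOn_const.mul hv) hr)]
  simp only [← smul_eq_mul]
  rw [Real.circleAverage_fun_smul, Real.circleAverage_fun_smul]

/-- Division by the modulus of `1 + ε h` truncates a function dominated by `Re h`. -/
lemma norm_mul_cpow_le {p ε : ℝ} (hp : 0 < p) (hε : 0 < ε) {x h : ℂ}
    (hx : ‖x‖ ^ (p / 2) ≤ h.re) :
    ‖x * (1 + ε * h) ^ ((-(2 / p) : ℝ) : ℂ)‖ ≤ ε⁻¹ ^ (2 / p) := by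
  have h0 : 0 ≤ h.re := le_trans (by positivity) hx
  have hre : 1 + ε * h.re ≤ ‖1 + ε * h‖ := by
    have := re_le_norm (1 + ε * h)
    simpa using this
  have hpos : 0 < ‖1 + ε * h‖ := lt_of_lt_of_le (by positivity) hre
  have hx' : ‖x‖ = (‖x‖ ^ (p / 2)) ^ (2 / p) := by
    rw [← Real.rpow_mul (norm_nonneg _)]
    field_simp
    simp
  rw [norm_mul, norm_cpow_real, Real.rpow_neg (norm_nonneg _), hx', ← Real.inv_rpow hpos.le,
    ← Real.mul_rpow (by positivity) (by positivity)]
  refine Real.rpow_le_rpow (by positivity) ?_ (by positivity)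
  rw [← div_eq_mul_inv, div_le_iff₀ hpos, inv_mul_eq_div, le_div_iff₀ hε]
  nlinarith

lemma exists_tail_sq_le {d : ℕ → ℂ} (hd : Summable fun n => ‖d n‖ ^ 2) {η : ℝ} (hη : 0 < η) :
    ∃ N, (Summable fun n => ‖if n < N then 0 else d n‖ ^ 2) ∧
      ∑' n, ‖if n < N then 0 else d n‖ ^ 2 ≤ η := by
  obtain ⟨N, hN⟩ : ∃ N, ∑' n, ‖d (n + N)‖ ^ 2 < η :=
    ((tendsto_sum_nat_add fun n => ‖d n‖ ^ 2).eventually (gt_mem_nhds hη)).exists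
  have h1 : HasSum (fun n => ‖if n + N < N then 0 else d (n + N)‖ ^ 2)
      (∑' n, ‖d (n + N)‖ ^ 2) := by
    simpa using ((summable_nat_add_iff (f := fun n => ‖d n‖ ^ 2) N).2 hd).hasSum
  have h2 := (hasSum_nat_add_iff (f := fun n => ‖if n < N then 0 else d n‖ ^ 2) N).1 h1
  rw [Finset.sum_eq_zero, add_zero] at h2
  · exact ⟨N, h2.summable, h2.tsum_eq.trans_le hN.le⟩
  · intro i hi
    simp [Finset.mem_range.1 hi]

/-- Bounded analytic functions are dense in `H^p`. -/
theorem exists_bounded_circleAverage_sub_le {f : ℂ → ℂ} (hf : DifferentiableOn ℂ f (ball 0 1))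
    {p : ℝ} (hp : 0 < p) {A : ℝ}
    (hA : ∀ r ∈ Ioo (0 : ℝ) 1, Real.circleAverage (fun z => ‖f z‖ ^ p) 0 r ≤ A) {η : ℝ}
    (hη : 0 < η) :
    ∃ (g : ℂ → ℂ) (K : ℝ), DifferentiableOn ℂ g (ball 0 1) ∧ (∀ z ∈ ball (0 : ℂ) 1, ‖g z‖ ≤ K) ∧
      ∀ r ∈ Ioo (0 : ℝ) 1, Real.circleAverage (fun z => ‖f z - g z‖ ^ p) 0 r ≤ η := by
  have hA0 : 0 ≤ A := le_trans
    (Real.circleAverage_nonneg_of_nonneg fun z _ => by positivity) (hA (1 / 2) (by norm_num))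
  have hA' : ∀ r ∈ Ioo (0 : ℝ) 1, Real.circleAverage (fun z => ‖f z‖ ^ (p / 2)) 0 r ≤ 1 + A := by
    intro r hr
    have h1 := circleAverage_le_of_le_on_ball (v := fun z => 1 * 1 + 1 * ‖f z‖ ^ p)
      (continuousOn_rpow_norm hf.continuousOn (half_pos hp))
      (continuousOn_const.add (continuousOn_const.mul (continuousOn_rpow_norm hf.continuousOn hp)))
      (fun z _ => by
        have h2 : ‖f z‖ ^ p = (‖f z‖ ^ (p / 2)) ^ 2 := by
          rw [← Real.rpow_natCast, ← Real.rpow_mul (norm_nonneg _)]; norm_num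
        rw [h2]
        nlinarith [sq_nonneg (‖f z‖ ^ (p / 2) - 1)]) hr
    rw [circleAverage_const_mul_add continuousOn_const
      (continuousOn_rpow_norm hf.continuousOn hp) 1 1 hr, Real.circleAverage_const] at h1
    linarith [hA r hr]
  obtain ⟨d, hdb, hd2, hfd⟩ := exists_harmonic_majorant hf (half_pos hp) hA'
  have hsum := hd2 A (fun r hr => by simpa [mul_div_cancel₀] using hA r hr)
  have hdsq : Summable fun n => ‖d n‖ ^ 2 := summable_of_sum_le (fun _ => by positivity) hsum
  have hdtsum : ∑' n, ‖d n‖ ^ 2 ≤ 4 * A := hdsq.tsum_le_of_sum_le hsum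
  set h : ℂ → ℂ := powerSum d with hh
  have hhd : DifferentiableOn ℂ h (ball 0 1) := differentiableOn_powerSum hdb
  -- split off a small tail
  set η' : ℝ := η / (4 * A + 4 * 2 ^ p + 1) with hη'
  have hη'0 : 0 < η' := by positivity
  obtain ⟨N, hasq, haη⟩ := exists_tail_sq_le hdsq hη'0
  set a : ℕ → ℂ := fun n => if n < N then 0 else d n with ha
  have hab : ∀ n, ‖a n‖ ≤ 2 * (1 + A) := fun n => by
    simp only [ha]
    split_ifs
    · simp; positivity
    · exact hdb n
  have hTd : DifferentiableOn ℂ (powerSum a) (ball 0 1) := differentiableOn_powerSum hab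
  set L : ℝ := ∑ n ∈ Finset.range N, ‖d n‖ with hL
  have hPT : ∀ z ∈ ball (0 : ℂ) 1, ‖h z - powerSum a z‖ ≤ L := by
    intro z hz
    have hz' : ‖z‖ < 1 := by simpa using hz
    have h1 := (hasSum_powerSum hdb hz).sub (hasSum_powerSum hab hz)
    have h2 : HasSum (fun n => d n * z ^ n - a n * z ^ n)
        (∑ n ∈ Finset.range N, (d n * z ^ n - a n * z ^ n)) := by
      refine hasSum_sum_of_ne_finset_zero fun n hn => ?_
      simp only [Finset.mem_range] at hn
      simp [ha, hn]
    rw [h1.unique h2]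
    refine (norm_sum_le _ _).trans (Finset.sum_le_sum fun n hn => ?_)
    simp only [Finset.mem_range] at hn
    simp only [ha, hn, if_true, zero_mul, sub_zero, norm_mul, norm_pow]
    exact mul_le_of_le_one_right (norm_nonneg _) (pow_le_one₀ (norm_nonneg _) hz'.le)
  -- the truncating factor
  have hcont : ContinuousAt (fun ζ : ℂ => ‖1 - (1 + ζ) ^ ((-(2 / p) : ℝ) : ℂ)‖ ^ p) 0 := by
    refine ContinuousAt.rpow_const (ContinuousAt.norm ?_) (Or.inr hp.le)
    refine continuousAt_const.sub (ContinuousAt.cpow (by fun_prop) continuousAt_const ?_)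
    simp
  obtain ⟨δ, hδ0, hδ⟩ : ∃ δ > 0, ∀ ζ : ℂ, ‖ζ‖ < δ →
      ‖1 - (1 + ζ) ^ ((-(2 / p) : ℝ) : ℂ)‖ ^ p ≤ η' := by
    have h1 := hcont.tendsto.eventually_le_const (u := η') (by simpa [hp.ne'] using hη'0)
    obtain ⟨δ, hδ0, hδ⟩ := Metric.eventually_nhds_iff.1 h1
    exact ⟨δ, hδ0, fun ζ hζ => hδ (by simpa using hζ)⟩
  have hL0 : 0 ≤ L := Finset.sum_nonneg fun _ _ => norm_nonneg _
  set ε : ℝ := δ / (2 * L + 1) with hε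
  have hε0 : 0 < ε := by positivity
  set g : ℂ → ℂ := fun z => f z * (1 + ε * h z) ^ ((-(2 / p) : ℝ) : ℂ) with hg
  have hre0 : ∀ z ∈ ball (0 : ℂ) 1, 0 ≤ (h z).re := fun z hz =>
    le_trans (by positivity) (hfd z hz)
  have hgd : DifferentiableOn ℂ g (ball 0 1) := by
    refine hf.mul (DifferentiableOn.cpow ((hhd.const_mul _).const_add _)
      (differentiableOn_const _) fun z hz => Or.inl ?_)
    have := hre0 z hz
    simp
    positivity
  refine ⟨g, ε⁻¹ ^ (2 / p), hgd, fun z hz => norm_mul_cpow_le hp hε0 (hfd z hz), ?_⟩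
  have hpt : ∀ z ∈ ball (0 : ℂ) 1, ‖f z - g z‖ ^ p ≤
      η' * ‖h z‖ ^ 2 + 4 * 2 ^ p * ‖powerSum a z‖ ^ 2 := by
    intro z hz
    have e1 : f z - g z = f z * (1 - (1 + ε * h z) ^ ((-(2 / p) : ℝ) : ℂ)) := by
      simp only [hg]; ring
    have hfh : ‖f z‖ ^ p ≤ ‖h z‖ ^ 2 := by
      have h2 : ‖f z‖ ^ p = (‖f z‖ ^ (p / 2)) ^ 2 := by
        rw [← Real.rpow_natCast, ← Real.rpow_mul (norm_nonneg _)]; norm_num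
      rw [h2]
      exact pow_le_pow_left₀ (by positivity) ((hfd z hz).trans (re_le_norm _)) 2
    rw [e1, norm_mul, Real.mul_rpow (norm_nonneg _) (norm_nonneg _)]
    have hεn : ‖(ε : ℂ) * h z‖ = ε * ‖h z‖ := by
      rw [norm_mul, norm_real, Real.norm_of_nonneg hε0.le]
    by_cases hsmall : ε * ‖h z‖ < δ
    · have h3 := hδ (ε * h z) (by rwa [hεn])
      calc _ ≤ ‖h z‖ ^ 2 * η' := by gcongr
        _ ≤ _ := by rw [mul_comm]; exact le_add_of_nonneg_right (by positivity)
    · push Not at hsmall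
      have h3 : 2 * L ≤ ‖h z‖ := by
        rw [hε, div_mul_eq_mul_div, le_div_iff₀ (by positivity)] at hsmall
        have := le_of_mul_le_mul_left hsmall hδ0
        linarith
      have h4 : ‖h z‖ ≤ 2 * ‖powerSum a z‖ := by
        have h5 := norm_sub_norm_le (h z) (powerSum a z)
        linarith [hPT z hz]
      have h6 : ‖1 - (1 + ε * h z) ^ ((-(2 / p) : ℝ) : ℂ)‖ ≤ 2 := by
        refine (norm_sub_le _ _).trans ?_
        rw [norm_one, norm_cpow_real]
        have h7 : 1 ≤ ‖1 + ε * h z‖ := by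
          refine le_trans ?_ (re_le_norm _)
          have := mul_nonneg hε0.le (hre0 z hz)
          simpa using this
        have := Real.rpow_le_one_of_one_le_of_nonpos h7
          (z := -(2 / p)) (by rw [neg_nonpos]; positivity)
        linarith
      calc _ ≤ (2 * ‖powerSum a z‖) ^ 2 * 2 ^ p := by
            gcongr
            exact hfh.trans (pow_le_pow_left₀ (norm_nonneg _) h4 2)
        _ = 4 * 2 ^ p * ‖powerSum a z‖ ^ 2 := by ring
        _ ≤ _ := le_add_of_nonneg_left (by positivity)
  intro r hr
  have hch : ContinuousOn (fun z => ‖h z‖ ^ 2) (ball 0 1) := hhd.continuousOn.norm.pow 2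
  have hcT : ContinuousOn (fun z => ‖powerSum a z‖ ^ 2) (ball 0 1) := hTd.continuousOn.norm.pow 2
  calc _ ≤ Real.circleAverage
        (fun z => η' * ‖h z‖ ^ 2 + 4 * 2 ^ p * ‖powerSum a z‖ ^ 2) 0 r :=
      circleAverage_le_of_le_on_ball
        (continuousOn_rpow_norm (hf.continuousOn.sub hgd.continuousOn) hp)
        ((continuousOn_const.mul hch).add (continuousOn_const.mul hcT)) hpt hr
    _ = η' * Real.circleAverage (fun z => ‖h z‖ ^ 2) 0 r +
        4 * 2 ^ p * Real.circleAverage (fun z => ‖powerSum a z‖ ^ 2) 0 r :=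
      circleAverage_const_mul_add hch hcT _ _ hr
    _ ≤ η' * (4 * A) + 4 * 2 ^ p * η' := by
      gcongr
      · exact (circleAverage_sq_powerSum_le hdsq hr).trans hdtsum
      · exact (circleAverage_sq_powerSum_le hasq hr).trans haη
    _ ≤ η' * (4 * A + 4 * 2 ^ p + 1) := by nlinarith
    _ = η := by rw [hη']; field_simp

section HilbertSemigroup

variable {E : Type*} [NormedAddCommGroup E] [InnerProductSpace ℂ E]

/-- The vectors `x` such that `T t x` tends to `x` as `t` tends to `0` from the right. -/
def strongContinuitySubmodule (T : ℝ → E →L[ℂ] E) : Submodule ℂ E where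
  carrier := {x | Tendsto (fun t => T t x) (𝓝[>] 0) (𝓝 x)}
  add_mem' {x y} hx hy := by
    simp only [mem_ofPred_eq, map_add] at hx hy ⊢
    exact hx.add hy
  zero_mem' := by simp
  smul_mem' c x hx := by
    simp only [mem_ofPred_eq, map_smul] at hx ⊢
    exact hx.const_smul c

lemma mem_strongContinuitySubmodule {T : ℝ → E →L[ℂ] E} {x : E} :
    x ∈ strongContinuitySubmodule T ↔ Tendsto (fun t => T t x) (𝓝[>] 0) (𝓝 x) := Iff.rfl

lemma isClosed_strongContinuitySubmodule {T : ℝ → E →L[ℂ] E} {C : ℝ}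
    (hC : ∀ᶠ t in 𝓝[>] (0 : ℝ), ‖T t‖ ≤ C) :
    IsClosed (strongContinuitySubmodule T : Set E) := by
  refine isClosed_of_closure_subset fun x hx => ?_
  have hC0 : 0 ≤ C := by
    obtain ⟨t, ht⟩ := hC.exists
    exact (norm_nonneg _).trans ht
  refine mem_strongContinuitySubmodule.2 (Metric.tendsto_nhds.2 fun ε hε => ?_)
  obtain ⟨y, hy, hxy⟩ := Metric.mem_closure_iff.1 hx (ε / (2 * (C + 1))) (by positivity)
  have hy' := Metric.tendsto_nhds.1 (mem_strongContinuitySubmodule.1 hy) (ε / 2) (half_pos hε)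
  filter_upwards [hC, hy'] with t ht hty
  rw [dist_eq_norm] at hxy hty ⊢
  rw [lt_div_iff₀ (by positivity)] at hxy
  have e : T t x - x = T t (x - y) + (T t y - y) - (x - y) := by rw [map_sub]; abel
  have h1 : ‖T t (x - y)‖ ≤ C * ‖x - y‖ := (T t).le_of_opNorm_le ht _
  have h2 : ‖T t x - x‖ ≤ ‖T t (x - y)‖ + ‖T t y - y‖ + ‖x - y‖ := by
    rw [e]
    exact (norm_sub_le _ _).trans (by gcongr; exact norm_add_le _ _)
  nlinarith

variable {A : ℝ → E →L[ℂ] E} {δ C : ℝ}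

/-- A locally bounded semigroup which is strongly continuous at the origin is strongly
continuous. -/
lemma continuousOn_semigroup_apply (hAC : ∀ t ∈ Icc 0 δ, ‖A t‖ ≤ C)
    (hA : ∀ s t, 0 ≤ s → 0 ≤ t → A (s + t) = A s ∘L A t) {y : E}
    (hy : Tendsto (fun t => A t y) (𝓝[>] 0) (𝓝 y)) :
    ContinuousOn (fun t => A t y) (Icc 0 δ) := by
  have hdiff : ∀ s ∈ Icc 0 δ, ∀ t ∈ Icc 0 δ, s ≤ t →
      ‖A t y - A s y‖ ≤ C * ‖A (t - s) y - y‖ := by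
    intro s hs t ht hst
    have h1 := hA s (t - s) hs.1 (sub_nonneg.2 hst)
    rw [add_sub_cancel] at h1
    rw [h1, ContinuousLinearMap.comp_apply, ← map_sub]
    exact (A s).le_of_opNorm_le (hAC s hs) _
  rcases lt_or_ge δ 0 with hδ | hδ
  · rw [Icc_eq_empty (not_le.2 hδ)]; exact continuousOn_empty _
  have hC0 : 0 ≤ C := (norm_nonneg _).trans (hAC 0 ⟨le_rfl, hδ⟩)
  refine Metric.continuousOn_iff.2 fun s hs ε hε => ?_
  have h2 := Metric.tendsto_nhds.1 hy (ε / (C + 1)) (by positivity)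
  obtain ⟨η, hη0, hη⟩ := Metric.mem_nhdsWithin_iff.1 h2
  have hsmall : ∀ u, 0 < u → u < η → C * ‖A u y - y‖ < ε := by
    intro u hu0 hu
    have h3 : dist (A u y) y < ε / (C + 1) :=
      hη ⟨by simpa [abs_of_pos hu0] using hu, hu0⟩
    rw [dist_eq_norm, lt_div_iff₀ (by positivity)] at h3
    nlinarith [norm_nonneg (A u y - y)]
  refine ⟨η, hη0, fun t ht hts => ?_⟩
  rw [Real.dist_eq] at hts
  rcases lt_trichotomy s t with h | h | h
  · rw [dist_eq_norm]
    exact (hdiff s hs t ht h.le).trans_lt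
      (hsmall _ (sub_pos.2 h) (by rwa [abs_of_pos (sub_pos.2 h)] at hts))
  · rw [h, dist_self]; exact hε
  · rw [dist_comm, dist_eq_norm]
    rw [abs_sub_comm] at hts
    exact (hdiff t ht s hs h.le).trans_lt
      (hsmall _ (sub_pos.2 h) (by rwa [abs_of_pos (sub_pos.2 h)] at hts))

/-- The operator of integration along a strongly continuous semigroup. -/
lemma exists_integral_operator (hAC : ∀ t ∈ Icc 0 δ, ‖A t‖ ≤ C)
    (hA : ∀ s t, 0 ≤ s → 0 ≤ t → A (s + t) = A s ∘L A t)
    (hAy : ∀ y, Tendsto (fun t => A t y) (𝓝[>] 0) (𝓝 y)) {ε : ℝ} (hε0 : 0 < ε)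
    (hεδ : ε ≤ δ / 2) :
    ∃ B : E →L[ℂ] E, (∀ y, B y = ∫ s in (0 : ℝ)..ε, A s y) ∧
      ∀ t ∈ Ioc 0 (δ / 2), ‖B ∘L A t - B‖ ≤ 2 * t * C := by
  have hδ : 0 < δ := by linarith
  have hC0 : 0 ≤ C := (norm_nonneg _).trans (hAC 0 ⟨le_rfl, hδ.le⟩)
  have hint : ∀ y, ∀ a ∈ Icc 0 δ, ∀ b ∈ Icc 0 δ,
      IntervalIntegrable (fun s => A s y) volume a b := fun y a ha b hb =>
    ((continuousOn_semigroup_apply hAC hA (hAy y)).mono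
      (uIcc_subset_Icc ha hb)).intervalIntegrable
  have hbound : ∀ y, ∀ a ∈ Icc 0 δ, ∀ b ∈ Icc 0 δ,
      ‖∫ s in a..b, A s y‖ ≤ C * ‖y‖ * |b - a| := fun y a ha b hb =>
    intervalIntegral.norm_integral_le_of_norm_le_const fun s hs =>
      (A s).le_of_opNorm_le (hAC s (uIcc_subset_Icc ha hb (uIoc_subset_uIcc hs))) y
  have h0δ : (0 : ℝ) ∈ Icc 0 δ := ⟨le_rfl, hδ.le⟩
  have hεm : ε ∈ Icc 0 δ := ⟨hε0.le, by linarith⟩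
  let B₀ : E →ₗ[ℂ] E :=
    { toFun := fun y => ∫ s in (0 : ℝ)..ε, A s y
      map_add' := fun x y => by
        simp only [map_add]
        exact intervalIntegral.integral_add (hint x _ h0δ _ hεm) (hint y _ h0δ _ hεm)
      map_smul' := fun c x => by
        simp only [map_smul, RingHom.id_apply]
        exact intervalIntegral.integral_smul c _ }
  let B : E →L[ℂ] E := B₀.mkContinuous (C * ε) fun y => by
    refine (hbound y 0 h0δ ε hεm).trans (le_of_eq ?_)
    rw [sub_zero, abs_of_pos hε0]; ring
  have hB : ∀ y, B y = ∫ s in (0 : ℝ)..ε, A s y := fun y => rfl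
  refine ⟨B, hB, fun t ht => ?_⟩
  refine ContinuousLinearMap.opNorm_le_bound _ (by have := ht.1; positivity) fun y => ?_
  have htm : t ∈ Icc 0 δ := ⟨ht.1.le, by linarith [ht.2]⟩
  have hetm : ε + t ∈ Icc 0 δ := ⟨by linarith [ht.1], by linarith [ht.2]⟩
  have h1 : B (A t y) = ∫ s in t..(ε + t), A s y := by
    rw [hB]
    have h2 := intervalIntegral.integral_comp_add_right (a := 0) (b := ε) (fun s => A s y) t
    rw [zero_add] at h2
    rw [← h2]
    refine intervalIntegral.integral_congr fun s hs => ?_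
    rw [uIcc_of_le hε0.le] at hs
    simp only [hA s t hs.1 ht.1.le, ContinuousLinearMap.comp_apply]
  have h3 : B (A t y) - B y = (∫ s in ε..(ε + t), A s y) - ∫ s in (0 : ℝ)..t, A s y := by
    rw [h1, hB]
    have e1 := intervalIntegral.integral_add_adjacent_intervals (hint y 0 h0δ t htm)
      (hint y t htm _ hetm)
    have e2 := intervalIntegral.integral_add_adjacent_intervals (hint y 0 h0δ ε hεm)
      (hint y ε hεm _ hetm)
    rw [sub_eq_sub_iff_add_eq_add, add_comm, e1, ← e2, add_comm]
  rw [sub_apply, ContinuousLinearMap.comp_apply, h3]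
  refine (norm_sub_le _ _).trans ?_
  have e3 := hbound y ε hεm _ hetm
  have e4 := hbound y 0 h0δ t htm
  rw [add_sub_cancel_left, abs_of_pos ht.1] at e3
  rw [sub_zero, abs_of_pos ht.1] at e4
  linarith

variable [CompleteSpace E]

/-- If the adjoint of a locally bounded operator semigroup on a Hilbert space is strongly
continuous on a total set, then the semigroup is strongly continuous. -/
theorem tendsto_semigroup_of_adjoint {T : ℝ → E →L[ℂ] E} (hδ : 0 < δ)
    (hTC : ∀ t ∈ Icc 0 δ, ‖T t‖ ≤ C)
    (hT : ∀ s t, 0 ≤ s → 0 ≤ t → T (s + t) = T s ∘L T t) {K : Set E}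
    (hK : (Submodule.span ℂ K).topologicalClosure = ⊤)
    (hTK : ∀ k ∈ K, Tendsto (fun t => (T t).adjoint k) (𝓝[>] 0) (𝓝 k)) (x : E) :
    Tendsto (fun t => T t x) (𝓝[>] 0) (𝓝 x) := by
  set A : ℝ → E →L[ℂ] E := fun t => (T t).adjoint with hAdef
  have hev : ∀ᶠ t in 𝓝[>] (0 : ℝ), t ∈ Icc 0 δ :=
    mem_of_superset (Ioc_mem_nhdsGT hδ) Ioc_subset_Icc_self
  have hAC : ∀ t ∈ Icc 0 δ, ‖A t‖ ≤ C := fun t ht => by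
    simpa [hAdef] using hTC t ht
  have hA : ∀ s t, 0 ≤ s → 0 ≤ t → A (s + t) = A s ∘L A t := fun s t hs ht => by
    simp only [hAdef]
    rw [add_comm, hT t s ht hs, ContinuousLinearMap.adjoint_comp]
  have hAy : ∀ y, Tendsto (fun t => A t y) (𝓝[>] 0) (𝓝 y) := by
    have h1 : (Submodule.span ℂ K).topologicalClosure ≤ strongContinuitySubmodule A :=
      Submodule.topologicalClosure_minimal _ (Submodule.span_le.2 fun k hk => hTK k hk)
        (isClosed_strongContinuitySubmodule (hev.mono hAC))
    rw [hK] at h1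
    exact fun y => h1 (Submodule.mem_top (x := y))
  set X := strongContinuitySubmodule T with hX
  have hXc : IsClosed (X : Set E) := isClosed_strongContinuitySubmodule (hev.mono hTC)
  have : CompleteSpace X := hXc.completeSpace_coe
  suffices hbot : Xᗮ = ⊥ by
    have h1 : X = ⊤ := Submodule.orthogonal_eq_bot_iff.1 hbot
    exact mem_strongContinuitySubmodule.1 (by rw [← hX, h1]; exact Submodule.mem_top)
  rw [eq_bot_iff]
  intro y hy
  rw [Submodule.mem_bot]
  have hzero : ∀ ε ∈ Ioc 0 (δ / 2), ∫ s in (0 : ℝ)..ε, A s y = 0 := by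
    intro ε hε
    obtain ⟨B, hB, hBA⟩ := exists_integral_operator hAC hA hAy hε.1 hε.2
    have hBX : ∀ x, B.adjoint x ∈ X := by
      intro x
      refine mem_strongContinuitySubmodule.2 ?_
      rw [tendsto_iff_norm_sub_tendsto_zero]
      have hlim : Tendsto (fun t : ℝ => 2 * t * C * ‖x‖) (𝓝[>] 0) (𝓝 0) := by
        have : Continuous fun t : ℝ => 2 * t * C * ‖x‖ := by fun_prop
        simpa using (this.tendsto 0).mono_left nhdsWithin_le_nhds
      refine squeeze_zero' (Eventually.of_forall fun _ => norm_nonneg _) ?_ hlim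
      filter_upwards [Ioc_mem_nhdsGT (half_pos hδ)] with t ht
      have e : T t (B.adjoint x) - B.adjoint x = (B ∘L A t - B).adjoint x := by
        simp [hAdef, ContinuousLinearMap.adjoint_comp]
      rw [e]
      refine ContinuousLinearMap.le_of_opNorm_le _ ?_ x
      rw [LinearIsometryEquiv.norm_map]
      exact hBA t ht
    rw [← hB]
    refine ext_inner_left ℂ fun x => ?_
    rw [← ContinuousLinearMap.adjoint_inner_left, inner_zero_right]
    exact hy _ (hBX x)
  by_contra hne
  have hpos : 0 < ‖y‖ := norm_pos_iff.2 hne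
  have h2 := Metric.tendsto_nhds.1 (hAy y) (‖y‖ / 2) (half_pos hpos)
  obtain ⟨η, hη0, hη⟩ := Metric.mem_nhdsWithin_iff.1 h2
  set ε := min (η / 2) (δ / 2) with hε
  have hε0 : 0 < ε := lt_min (half_pos hη0) (half_pos hδ)
  have hεη : ε < η := (min_le_left _ _).trans_lt (half_lt_self hη0)
  have hεδ : ε ≤ δ / 2 := min_le_right _ _
  have h3 : ‖∫ s in (0 : ℝ)..ε, (A s y - y)‖ ≤ ‖y‖ / 2 * |ε - 0| := by
    refine intervalIntegral.norm_integral_le_of_norm_le_const fun s hs => ?_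
    rw [uIoc_of_le hε0.le] at hs
    have h4 : dist (A s y) y < ‖y‖ / 2 :=
      hη ⟨by simpa [abs_of_pos hs.1] using hs.2.trans_lt hεη, hs.1⟩
    rw [dist_eq_norm] at h4
    exact h4.le
  have hci : IntervalIntegrable (fun s => A s y) volume 0 ε :=
    ((continuousOn_semigroup_apply hAC hA (hAy y)).mono
      (uIcc_subset_Icc ⟨le_rfl, hδ.le⟩ ⟨hε0.le, by linarith⟩)).intervalIntegrable
  rw [intervalIntegral.integral_sub hci intervalIntegrable_const, hzero ε ⟨hε0, hεδ⟩,
    intervalIntegral.integral_const, zero_sub, norm_neg, norm_smul, sub_zero,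
    Real.norm_of_nonneg hε0.le, abs_of_pos hε0] at h3
  nlinarith [mul_pos hε0 hpos]

end HilbertSemigroup

lemma circleAverage_weighted_comp_le {f : ℂ → ℂ} (hf : DifferentiableOn ℂ f (ball 0 1)) {q : ℝ}
    (hq : 0 < q) {A : ℝ}
    (hA : ∀ r ∈ Ioo (0 : ℝ) 1, Real.circleAverage (fun z => ‖f z‖ ^ q) 0 r ≤ A)
    {ψ μ : ℂ → ℂ} (hψ : DifferentiableOn ℂ ψ (ball 0 1)) (hψm : MapsTo ψ (ball 0 1) (ball 0 1))
    (hμ : DifferentiableOn ℂ μ (ball 0 1)) {M : ℝ} (hM : ∀ z ∈ ball (0 : ℂ) 1, ‖μ z‖ ≤ M)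
    {r : ℝ} (hr : r ∈ Ioo (0 : ℝ) 1) :
    Real.circleAverage (fun z => ‖μ z * f (ψ z)‖ ^ q) 0 r ≤ M ^ q * (2 * A / (1 - ‖ψ 0‖)) := by
  have hM0 : 0 ≤ M := (norm_nonneg _).trans (hM 0 (mem_ball_self one_pos))
  have hfψ : ContinuousOn (fun z => f (ψ z)) (ball 0 1) :=
    hf.continuousOn.comp hψ.continuousOn hψm
  calc _ ≤ Real.circleAverage (fun z => M ^ q * ‖f (ψ z)‖ ^ q) 0 r := by
        refine circleAverage_le_of_le_on_ball (u := fun z => ‖μ z * f (ψ z)‖ ^ q)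
          (v := fun z => M ^ q * ‖f (ψ z)‖ ^ q)
          (continuousOn_rpow_norm (hμ.continuousOn.mul hfψ) hq)
          (continuousOn_const.mul (continuousOn_rpow_norm hfψ hq)) (fun z hz => ?_) hr
        rw [norm_mul, Real.mul_rpow (norm_nonneg _) (norm_nonneg _)]
        have := hM z hz
        gcongr
    _ = M ^ q * Real.circleAverage (fun z => ‖f (ψ z)‖ ^ q) 0 r := by
        simp only [← smul_eq_mul]
        rw [Real.circleAverage_fun_smul]
    _ ≤ _ := by
        gcongr
        exact circleAverage_comp_le hf hq hA hψ hψm hr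

/-- Square-summable sequences, the coefficient space of `H^2`. -/
noncomputable abbrev SqSeq := lp (fun _ : ℕ => ℂ) 2

namespace SqSeq

lemma hasSum_sq (x : SqSeq) : HasSum (fun n => ‖x n‖ ^ 2) (‖x‖ ^ 2) := by
  have h := lp.hasSum_norm (p := 2) (by norm_num) x
  simpa using h

lemma norm_apply_le (x : SqSeq) (n : ℕ) : ‖x n‖ ≤ ‖x‖ :=
  lp.norm_apply_le_norm (by norm_num) x n

lemma differentiableOn (x : SqSeq) : DifferentiableOn ℂ (powerSum x) (ball 0 1) :=
  differentiableOn_powerSum (norm_apply_le x)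

lemma circleAverage_le (x : SqSeq) {r : ℝ} (hr : r ∈ Ioo (0 : ℝ) 1) :
    Real.circleAverage (fun z => ‖powerSum x z‖ ^ (2 : ℝ)) 0 r ≤ ‖x‖ ^ 2 := by
  simpa [(hasSum_sq x).tsum_eq] using circleAverage_sq_powerSum_le (hasSum_sq x).summable hr

lemma powerSum_add (x y : SqSeq) {z : ℂ} (hz : z ∈ ball (0 : ℂ) 1) :
    powerSum (x + y : SqSeq) z = powerSum x z + powerSum y z := by
  rw [← ((hasSum_powerSum (norm_apply_le x) hz).add (hasSum_powerSum (norm_apply_le y) hz)).tsum_eq]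
  exact tsum_congr fun n => by simp [add_mul]

lemma powerSum_smul (c : ℂ) (x : SqSeq) {z : ℂ} (hz : z ∈ ball (0 : ℂ) 1) :
    powerSum (c • x : SqSeq) z = c * powerSum x z := by
  rw [← ((hasSum_powerSum (norm_apply_le x) hz).mul_left c).tsum_eq]
  exact tsum_congr fun n => by simp [mul_assoc]

lemma powerSum_sub (x y : SqSeq) {z : ℂ} (hz : z ∈ ball (0 : ℂ) 1) :
    powerSum (x - y : SqSeq) z = powerSum x z - powerSum y z := by
  rw [← ((hasSum_powerSum (norm_apply_le x) hz).sub (hasSum_powerSum (norm_apply_le y) hz)).tsum_eq]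
  exact tsum_congr fun n => by simp [sub_mul]

lemma ext_powerSum {x y : SqSeq} (h : ∀ z ∈ ball (0 : ℂ) 1, powerSum x z = powerSum y z) :
    x = y := by
  have hr : (1 / 2 : ℝ) ∈ Ioo (0 : ℝ) 1 := by norm_num
  refine lp.ext (funext fun n => ?_)
  rw [← taylorCoeff_powerSum (norm_apply_le x) n, ← taylorCoeff_powerSum (norm_apply_le y) n,
    ← circleAverage_zpow_mul (SqSeq.differentiableOn x) hr,
    ← circleAverage_zpow_mul (SqSeq.differentiableOn y) hr]
  refine Real.circleAverage_congr_sphere fun z hz => ?_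
  simp only [h z (sphere_subset_unit_ball hr hz)]

/-- An analytic function with bounded quadratic means is given by a square-summable sequence. -/
lemma exists_powerSum_eq {F : ℂ → ℂ} (hF : DifferentiableOn ℂ F (ball 0 1)) {B : ℝ}
    (hB : ∀ r ∈ Ioo (0 : ℝ) 1, Real.circleAverage (fun z => ‖F z‖ ^ (2 : ℝ)) 0 r ≤ B) :
    ∃ x : SqSeq, (∀ z ∈ ball (0 : ℂ) 1, powerSum x z = F z) ∧ ‖x‖ ^ 2 ≤ B := by
  simp only [Real.rpow_two] at hB
  have hs := summable_sq_taylorCoeff hF hB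
  let x : SqSeq := ⟨taylorCoeff F, memℓp_gen (by simpa using hs)⟩
  refine ⟨x, fun z hz => powerSum_taylorCoeff hF hz, ?_⟩
  rw [← (hasSum_sq x).tsum_eq]
  exact hs.tsum_le_of_sum_le (sum_sq_taylorCoeff_le hF hB)

/-- Weighted composition operators act boundedly on `H^2`. -/
lemma exists_weighted_comp {ψ μ : ℂ → ℂ} (hψ : DifferentiableOn ℂ ψ (ball 0 1))
    (hψm : MapsTo ψ (ball 0 1) (ball 0 1)) (hμ : DifferentiableOn ℂ μ (ball 0 1)) {M : ℝ}
    (hM : ∀ z ∈ ball (0 : ℂ) 1, ‖μ z‖ ≤ M) :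
    ∃ W : SqSeq →L[ℂ] SqSeq,
      (∀ x, ∀ z ∈ ball (0 : ℂ) 1, powerSum (W x) z = μ z * powerSum x (ψ z)) ∧
      ‖W‖ ≤ M * √(2 / (1 - ‖ψ 0‖)) := by
  have hM0 : 0 ≤ M := (norm_nonneg _).trans (hM 0 (mem_ball_self one_pos))
  have hex : ∀ x : SqSeq, ∃ y : SqSeq,
      (∀ z ∈ ball (0 : ℂ) 1, powerSum y z = μ z * powerSum x (ψ z)) ∧
        ‖y‖ ^ 2 ≤ M ^ 2 * (2 * ‖x‖ ^ 2 / (1 - ‖ψ 0‖)) := fun x => by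
    refine exists_powerSum_eq (F := fun z => μ z * powerSum x (ψ z))
      (hμ.mul ((SqSeq.differentiableOn x).comp hψ hψm)) fun r hr => ?_
    have := circleAverage_weighted_comp_le (SqSeq.differentiableOn x) two_pos
      (fun r hr => SqSeq.circleAverage_le x hr) hψ hψm hμ hM hr
    rw [Real.rpow_two] at this
    exact this
  choose W hW hWn using hex
  have hψ0 : 0 < 1 - ‖ψ 0‖ := by
    have := hψm (mem_ball_self one_pos)
    rw [mem_ball_zero_iff] at this
    linarith
  let W₀ : SqSeq →ₗ[ℂ] SqSeq :=
    { toFun := W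
      map_add' := fun x y => ext_powerSum fun z hz => by
        rw [powerSum_add _ _ hz, hW _ z hz, hW _ z hz, hW _ z hz, powerSum_add _ _ (hψm hz),
          mul_add]
      map_smul' := fun c x => ext_powerSum fun z hz => by
        rw [RingHom.id_apply, powerSum_smul _ _ hz, hW _ z hz, hW _ z hz,
          powerSum_smul _ _ (hψm hz)]
        ring }
  have hb : ∀ x, ‖W₀ x‖ ≤ M * √(2 / (1 - ‖ψ 0‖)) * ‖x‖ := by
    intro x
    refine (sq_le_sq₀ (norm_nonneg _) (by positivity)).1 ((hWn x).trans (le_of_eq ?_))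
    rw [mul_pow, mul_pow, Real.sq_sqrt (by positivity)]
    ring
  exact ⟨W₀.mkContinuous _ hb, hW, W₀.mkContinuous_norm_le (by positivity) hb⟩

lemma exists_kernel {w : ℂ} (hw : w ∈ ball (0 : ℂ) 1) :
    ∃ k : SqSeq, ∀ n, k n = (starRingEnd ℂ) w ^ n := by
  have hw' : ‖w‖ < 1 := by simpa using hw
  have hs : Summable fun n : ℕ => ‖(starRingEnd ℂ) w ^ n‖ ^ 2 := by
    have := summable_geometric_of_lt_one (r := ‖w‖ ^ 2) (by positivity)
      (pow_lt_one₀ (norm_nonneg _) hw' two_ne_zero)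
    refine this.congr fun n => ?_
    rw [norm_pow, RCLike.norm_conj]
    ring
  exact ⟨⟨_, memℓp_gen (by simpa using hs)⟩, fun n => rfl⟩

open Classical in
/-- The reproducing kernel of `H^2`. -/
noncomputable def kernel (w : ℂ) : SqSeq :=
  if hw : w ∈ ball (0 : ℂ) 1 then (exists_kernel hw).choose else 0

lemma kernel_apply {w : ℂ} (hw : w ∈ ball (0 : ℂ) 1) (n : ℕ) :
    kernel w n = (starRingEnd ℂ) w ^ n := by
  rw [kernel, dif_pos hw]
  exact (exists_kernel hw).choose_spec n

lemma inner_kernel {w : ℂ} (hw : w ∈ ball (0 : ℂ) 1) (x : SqSeq) :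
    inner ℂ (kernel w) x = powerSum x w := by
  rw [lp.inner_eq_tsum]
  refine tsum_congr fun n => ?_
  rw [kernel_apply hw, RCLike.inner_apply, map_pow, conj_conj]

lemma powerSum_kernel {w z : ℂ} (hw : w ∈ ball (0 : ℂ) 1) (hz : z ∈ ball (0 : ℂ) 1) :
    powerSum (kernel w) z = (1 - (starRingEnd ℂ) w * z)⁻¹ := by
  rw [powerSum, ← tsum_geometric_of_norm_lt_one]
  · exact tsum_congr fun n => by rw [kernel_apply hw, mul_pow]
  · rw [norm_mul, RCLike.norm_conj]
    have hw' : ‖w‖ < 1 := by simpa using hw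
    have hz' : ‖z‖ < 1 := by simpa using hz
    nlinarith [norm_nonneg w, norm_nonneg z]

lemma continuousOn_kernel : ContinuousOn kernel (ball 0 1) := by
  intro z hz
  rw [ContinuousWithinAt, tendsto_iff_norm_sub_tendsto_zero]
  have hne : 1 - (starRingEnd ℂ) z * z ≠ 0 := by
    have hz' : ‖z‖ < 1 := by simpa using hz
    intro h
    have h1 : ‖(starRingEnd ℂ) z * z‖ = 1 := by rw [← sub_eq_zero.1 h]; simp
    rw [norm_mul, RCLike.norm_conj] at h1
    nlinarith [norm_nonneg z]
  set D : ℂ → ℂ := fun w => (1 - (starRingEnd ℂ) w * w)⁻¹ - (1 - (starRingEnd ℂ) z * w)⁻¹ -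
    ((1 - (starRingEnd ℂ) w * z)⁻¹ - (1 - (starRingEnd ℂ) z * z)⁻¹) with hD
  have hDc : ContinuousAt D z := by
    refine ContinuousAt.sub (ContinuousAt.sub ?_ ?_) (ContinuousAt.sub ?_ continuousAt_const)
    all_goals
      refine ContinuousAt.inv₀ (Continuous.continuousAt ?_) hne
      fun_prop
  have hDeq : ∀ w ∈ ball (0 : ℂ) 1, ‖kernel w - kernel z‖ = √(D w).re := by
    intro w hw
    rw [norm_eq_sqrt_re_inner (𝕜 := ℂ)]
    congr 2
    rw [inner_sub_left, inner_kernel hw, inner_kernel hz, powerSum_sub _ _ hw, powerSum_sub _ _ hz,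
      powerSum_kernel hw hw, powerSum_kernel hw hz, powerSum_kernel hz hw, powerSum_kernel hz hz]
    rfl
  have hlim : Tendsto (fun w => √(D w).re) (𝓝[ball 0 1] z) (𝓝 0) := by
    have h1 : ContinuousAt (fun w => √(D w).re) z :=
      (continuous_re.continuousAt.comp hDc).sqrt
    have h2 : √(D z).re = 0 := by simp [hD]
    rw [ContinuousAt, h2] at h1
    exact h1.mono_left nhdsWithin_le_nhds
  refine hlim.congr' ?_
  filter_upwards [self_mem_nhdsWithin] with w hw
  exact (hDeq w hw).symm

lemma closure_span_kernel :
    (Submodule.span ℂ (kernel '' ball 0 1)).topologicalClosure = ⊤ := by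
  rw [Submodule.topologicalClosure_eq_top_iff, eq_bot_iff]
  intro x hx
  rw [Submodule.mem_bot]
  refine ext_powerSum fun z hz => ?_
  rw [← inner_kernel hz, ← inner_kernel hz, inner_zero_right]
  exact hx _ (Submodule.subset_span ⟨z, hz, rfl⟩)

lemma adjoint_kernel {W : SqSeq →L[ℂ] SqSeq} {ψ μ : ℂ → ℂ} (hψm : MapsTo ψ (ball 0 1) (ball 0 1))
    (hW : ∀ x, ∀ z ∈ ball (0 : ℂ) 1, powerSum (W x) z = μ z * powerSum x (ψ z)) {z : ℂ}
    (hz : z ∈ ball (0 : ℂ) 1) :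
    W.adjoint (kernel z) = (starRingEnd ℂ) (μ z) • kernel (ψ z) := by
  refine ext_inner_right ℂ fun x => ?_
  rw [ContinuousLinearMap.adjoint_inner_left, inner_kernel hz, hW x z hz, inner_smul_left,
    conj_conj, inner_kernel (hψm hz)]

end SqSeq

section Semigroup

variable {φ m : ℝ → ℂ → ℂ}

/-- The means of `S_t g - g` of order two tend to zero uniformly in the radius. -/
lemma eventually_circleAverage_sq_sub_le
    (hφmap : ∀ t, 0 ≤ t → MapsTo (φ t) (ball 0 1) (ball 0 1))
    (hφan : ∀ t, 0 ≤ t → DifferentiableOn ℂ (φ t) (ball 0 1))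
    (hφ0 : ∀ z ∈ ball (0 : ℂ) 1, φ 0 z = z)
    (hφsemi : ∀ s, 0 ≤ s → ∀ t, 0 ≤ t → ∀ z ∈ ball (0 : ℂ) 1, φ (t + s) z = φ t (φ s z))
    (hφcont : ∀ z ∈ ball (0 : ℂ) 1, Tendsto (fun t => φ t z) (𝓝[>] (0 : ℝ)) (𝓝 z))
    (hman : ∀ t, 0 ≤ t → DifferentiableOn ℂ (m t) (ball 0 1))
    (hm0 : ∀ z ∈ ball (0 : ℂ) 1, m 0 z = 1)
    (hmcoc : ∀ s, 0 ≤ s → ∀ t, 0 ≤ t → ∀ z ∈ ball (0 : ℂ) 1, m (t + s) z = m t z * m s (φ t z))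
    (hmcont : ∀ z ∈ ball (0 : ℂ) 1, Tendsto (fun t => m t z) (𝓝[>] (0 : ℝ)) (𝓝 1))
    {M : ℝ} (hM1 : 1 ≤ M)
    (hM : ∀ᶠ t in 𝓝[>] (0 : ℝ), ∀ z ∈ ball (0 : ℂ) 1, ‖m t z‖ ≤ M)
    (hφ0M : ∀ᶠ t in 𝓝[>] (0 : ℝ), ‖φ t 0‖ ≤ 1 / 2)
    (hbdd : ∀ t, 0 ≤ t → ∃ C : ℝ, ∀ z ∈ ball (0 : ℂ) 1, ‖m t z‖ ≤ C)
    {g : ℂ → ℂ} (hg : DifferentiableOn ℂ g (ball 0 1)) {B : ℝ}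
    (hB : ∀ r ∈ Ioo (0 : ℝ) 1, Real.circleAverage (fun z => ‖g z‖ ^ (2 : ℝ)) 0 r ≤ B)
    {η : ℝ} (hη : 0 < η) :
    ∀ᶠ t in 𝓝[>] (0 : ℝ), ∀ r ∈ Ioo (0 : ℝ) 1,
      Real.circleAverage (fun z => ‖m t z * g (φ t z) - g z‖ ^ (2 : ℝ)) 0 r ≤ η := by
  have hT' : ∀ t : ℝ, ∃ W : SqSeq →L[ℂ] SqSeq, 0 ≤ t →
      (∀ x, ∀ z ∈ ball (0 : ℂ) 1, powerSum (W x) z = m t z * powerSum x (φ t z)) ∧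
      ∀ C, (∀ z ∈ ball (0 : ℂ) 1, ‖m t z‖ ≤ C) → ‖W‖ ≤ C * √(2 / (1 - ‖φ t 0‖)) := by
    intro t
    by_cases ht : 0 ≤ t
    · obtain ⟨C, hC⟩ := hbdd t ht
      obtain ⟨W, hW, -⟩ := SqSeq.exists_weighted_comp (hφan t ht) (hφmap t ht) (hman t ht) hC
      refine ⟨W, fun _ => ⟨hW, fun C' hC' => ?_⟩⟩
      obtain ⟨W', hW', hn⟩ := SqSeq.exists_weighted_comp (hφan t ht) (hφmap t ht) (hman t ht) hC'
      have : W = W' := ContinuousLinearMap.ext fun x =>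
        SqSeq.ext_powerSum fun z hz => by rw [hW x z hz, hW' x z hz]
      rwa [this]
    · exact ⟨0, fun h => absurd h ht⟩
  choose T hTall using hT'
  have hT := fun t ht => (hTall t ht).1
  obtain ⟨δ, hδ, hδM⟩ := (mem_nhdsGT_iff_exists_Ioc_subset).1 (hM.and hφ0M)
  have hTC : ∀ t ∈ Icc 0 δ, ‖T t‖ ≤ M * √4 := by
    intro t ht
    have hbd : (∀ z ∈ ball (0 : ℂ) 1, ‖m t z‖ ≤ M) ∧ ‖φ t 0‖ ≤ 1 / 2 := by
      rcases ht.1.eq_or_lt with rfl | h0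
      · refine ⟨fun z hz => by simpa [hm0 z hz] using hM1, ?_⟩
        rw [hφ0 0 (mem_ball_self one_pos)]
        norm_num
      · exact hδM ⟨h0, ht.2⟩
    refine ((hTall t ht.1).2 M hbd.1).trans ?_
    gcongr
    rw [div_le_iff₀ (by linarith [hbd.2])]
    linarith [hbd.2]
  have hTadd : ∀ s t, 0 ≤ s → 0 ≤ t → T (s + t) = T s ∘L T t := by
    intro s t hs ht
    refine ContinuousLinearMap.ext fun x => SqSeq.ext_powerSum fun z hz => ?_
    rw [ContinuousLinearMap.comp_apply, hT _ (add_nonneg hs ht) x z hz, hT s hs _ z hz,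
      hT t ht _ _ (hφmap s hs hz), hmcoc t ht s hs z hz, add_comm s t, hφsemi s hs t ht z hz,
      mul_assoc]
  have hTK : ∀ k ∈ SqSeq.kernel '' ball 0 1,
      Tendsto (fun t => (T t).adjoint k) (𝓝[>] 0) (𝓝 k) := by
    rintro _ ⟨z, hz, rfl⟩
    have h1 : Tendsto (fun t => (starRingEnd ℂ) (m t z)) (𝓝[>] 0) (𝓝 1) := by
      simpa using (hmcont z hz).star
    have h2 : Tendsto (fun t => SqSeq.kernel (φ t z)) (𝓝[>] 0) (𝓝 (SqSeq.kernel z)) := by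
      refine (SqSeq.continuousOn_kernel z hz).tendsto.comp (tendsto_nhdsWithin_iff.2
        ⟨hφcont z hz, ?_⟩)
      filter_upwards [self_mem_nhdsWithin] with t ht
      exact hφmap t (le_of_lt ht) hz
    have h3 := h1.smul h2
    rw [one_smul] at h3
    refine h3.congr' ?_
    filter_upwards [self_mem_nhdsWithin] with t ht
    exact (SqSeq.adjoint_kernel (hφmap t (le_of_lt ht)) (hT t (le_of_lt ht)) hz).symm
  obtain ⟨x, hx, -⟩ := SqSeq.exists_powerSum_eq hg hB
  have hlim := tendsto_semigroup_of_adjoint hδ hTC hTadd SqSeq.closure_span_kernel hTK x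
  rw [tendsto_iff_norm_sub_tendsto_zero] at hlim
  have hlim2 : Tendsto (fun t => ‖T t x - x‖ ^ 2) (𝓝[>] 0) (𝓝 0) := by
    simpa using hlim.pow 2
  filter_upwards [hlim2.eventually (gt_mem_nhds hη), self_mem_nhdsWithin] with t ht ht0 r hr
  have ht0' : 0 ≤ t := le_of_lt ht0
  refine le_trans (le_of_eq ?_) ((SqSeq.circleAverage_le (T t x - x) hr).trans ht.le)
  refine Real.circleAverage_congr_sphere fun z hz => ?_
  have hz1 := sphere_subset_unit_ball hr hz
  simp only [SqSeq.powerSum_sub _ _ hz1, hT t ht0' x z hz1, hx z hz1, hx _ (hφmap t ht0' hz1)]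

/-- A cocycle that is bounded near zero is bounded at every time. -/
lemma cocycle_bounded
    (hφmap : ∀ t, 0 ≤ t → MapsTo (φ t) (ball 0 1) (ball 0 1))
    (hm0 : ∀ z ∈ ball (0 : ℂ) 1, m 0 z = 1)
    (hmcoc : ∀ s, 0 ≤ s → ∀ t, 0 ≤ t → ∀ z ∈ ball (0 : ℂ) 1, m (t + s) z = m t z * m s (φ t z))
    {M : ℝ} (hM : ∀ᶠ t in 𝓝[>] (0 : ℝ), ∀ z ∈ ball (0 : ℂ) 1, ‖m t z‖ ≤ M)
    {t : ℝ} (ht : 0 ≤ t) : ∃ C : ℝ, ∀ z ∈ ball (0 : ℂ) 1, ‖m t z‖ ≤ C := by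
  rcases ht.eq_or_lt with rfl | ht
  · exact ⟨1, fun z hz => by simp [hm0 z hz]⟩
  obtain ⟨δ, hδ, hδM⟩ := (mem_nhdsGT_iff_exists_Ioc_subset).1 hM
  obtain ⟨n, hn⟩ := exists_nat_gt (t / δ)
  have hδ0 : 0 < δ := hδ
  have hn0 : (0 : ℝ) < n := (div_pos ht hδ0).trans hn
  have htn : 0 < t / n := div_pos ht hn0
  have hmem : ∀ z ∈ ball (0 : ℂ) 1, ‖m (t / n) z‖ ≤ M := hδM ⟨htn, by
    rw [div_le_iff₀ hn0]
    rw [div_lt_iff₀ hδ0] at hn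
    linarith⟩
  have hM0 : 0 ≤ M := (norm_nonneg _).trans (hmem 0 (mem_ball_self one_pos))
  have hind : ∀ k : ℕ, ∀ z ∈ ball (0 : ℂ) 1, ‖m (k * (t / n)) z‖ ≤ M ^ k := by
    intro k
    induction k with
    | zero => intro z hz; simp [hm0 z hz]
    | succ k ih =>
      intro z hz
      have hk : 0 ≤ (k : ℝ) * (t / n) := by positivity
      rw [Nat.cast_succ, add_one_mul, hmcoc _ htn.le _ hk z hz, norm_mul, pow_succ]
      exact mul_le_mul (ih z hz) (hmem _ (hφmap _ hk hz)) (norm_nonneg _) (by positivity)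
  refine ⟨M ^ n, fun z hz => ?_⟩
  have := hind n z hz
  rwa [mul_div_cancel₀ _ hn0.ne'] at this

end Semigroup

lemma rpow_norm_add_sub_le {p : ℝ} (hp : 0 < p) (a b c : ℂ) :
    ‖a + b - c‖ ^ p ≤ 3 ^ p * ‖a‖ ^ p + 1 * (3 ^ p * ‖b‖ ^ p + 3 ^ p * ‖c‖ ^ p) := by
  have key : ∀ y : ℝ, 0 ≤ y → ‖a‖ ≤ y → ‖b‖ ≤ y → ‖c‖ ≤ y → ‖a + b - c‖ ^ p ≤ 3 ^ p * y ^ p := by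
    intro y hy ha hb hc
    rw [← Real.mul_rpow (by norm_num) hy]
    gcongr
    linarith [norm_sub_le (a + b) c, norm_add_le a b]
  have ha := Real.rpow_nonneg (norm_nonneg a) p
  have hb := Real.rpow_nonneg (norm_nonneg b) p
  have hc := Real.rpow_nonneg (norm_nonneg c) p
  have h3 : (0 : ℝ) ≤ 3 ^ p := by positivity
  have ha3 := mul_nonneg h3 ha
  have hb3 := mul_nonneg h3 hb
  have hc3 := mul_nonneg h3 hc
  rcases le_total ‖a‖ ‖b‖ with hab | hab <;> rcases le_total ‖b‖ ‖c‖ with hbc | hbc <;>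
    rcases le_total ‖a‖ ‖c‖ with hac | hac
  all_goals
    first
    | linarith [key ‖a‖ (norm_nonneg a) le_rfl (by linarith) (by linarith)]
    | linarith [key ‖b‖ (norm_nonneg b) (by linarith) le_rfl (by linarith)]
    | linarith [key ‖c‖ (norm_nonneg c) (by linarith) (by linarith) le_rfl]

lemma exists_rpow_le_add_mul_sq {p : ℝ} (hp : 0 < p) {K : ℝ} (hK : 0 ≤ K) {ε : ℝ} (hε : 0 < ε) :
    ∃ c, 0 ≤ c ∧ ∀ x, 0 ≤ x → x ≤ K → x ^ p ≤ ε + c * x ^ (2 : ℝ) := by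
  have hs : 0 < ε ^ (1 / p) := by positivity
  refine ⟨K ^ p / (ε ^ (1 / p)) ^ (2 : ℝ), by positivity, fun x hx hxK => ?_⟩
  rcases le_total x (ε ^ (1 / p)) with h | h
  · have h1 : x ^ p ≤ (ε ^ (1 / p)) ^ p := by gcongr
    rw [← Real.rpow_mul hε.le, one_div_mul_cancel hp.ne', Real.rpow_one] at h1
    have : 0 ≤ K ^ p / (ε ^ (1 / p)) ^ (2 : ℝ) * x ^ (2 : ℝ) := by positivity
    linarith
  · have h1 : x ^ p ≤ K ^ p := by gcongr
    have h2 : K ^ p ≤ K ^ p / (ε ^ (1 / p)) ^ (2 : ℝ) * x ^ (2 : ℝ) := by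
      rw [div_mul_eq_mul_div, le_div_iff₀ (by positivity)]
      gcongr
    linarith

section HardyNorm

variable {p : ℝ} {f : ℂ → ℂ}

lemma hardyMeanP_nonneg (p : ℝ) (f : ℂ → ℂ) (r : ℝ) : 0 ≤ hardyMeanP p f r := by
  refine mul_nonneg (inv_nonneg.2 Real.two_pi_pos.le) ?_
  exact intervalIntegral.integral_nonneg Real.two_pi_pos.le fun _ _ => by positivity

lemma iSup_hardyMeanP_nonneg (p : ℝ) (f : ℂ → ℂ) :
    0 ≤ ⨆ r : Ioo (0 : ℝ) 1, hardyMeanP p f (r : ℝ) :=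
  Real.iSup_nonneg fun _ => hardyMeanP_nonneg p f _

lemma MemHardy.circleAverage_le (hf : MemHardy p f) :
    ∀ r ∈ Ioo (0 : ℝ) 1, Real.circleAverage (fun z => ‖f z‖ ^ p) 0 r ≤
      ⨆ r : Ioo (0 : ℝ) 1, hardyMeanP p f (r : ℝ) := by
  intro r hr
  rw [← hardyMeanP_eq_circleAverage]
  exact le_ciSup hf.2 (⟨r, hr⟩ : Ioo (0 : ℝ) 1)

lemma memHardy_of_circleAverage_le (hf : DifferentiableOn ℂ f (ball 0 1)) {B : ℝ}
    (hB : ∀ r ∈ Ioo (0 : ℝ) 1, Real.circleAverage (fun z => ‖f z‖ ^ p) 0 r ≤ B) :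
    MemHardy p f := by
  refine ⟨hf, B, ?_⟩
  rintro _ ⟨r, rfl⟩
  exact (hardyMeanP_eq_circleAverage p f r).trans_le (hB r r.2)

lemma hardyNorm_nonneg (p : ℝ) (f : ℂ → ℂ) : 0 ≤ hardyNorm p f :=
  Real.rpow_nonneg (iSup_hardyMeanP_nonneg p f) _

lemma hardyNorm_le (hp : 0 < p) {B : ℝ}
    (hB : ∀ r ∈ Ioo (0 : ℝ) 1, Real.circleAverage (fun z => ‖f z‖ ^ p) 0 r ≤ B) :
    hardyNorm p f ≤ B ^ (1 / p) := by
  have : Nonempty (Ioo (0 : ℝ) 1) := ⟨⟨1 / 2, by norm_num⟩⟩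
  refine Real.rpow_le_rpow (iSup_hardyMeanP_nonneg p f) (ciSup_le fun r => ?_) (by positivity)
  exact (hardyMeanP_eq_circleAverage p f r).trans_le (hB r r.2)

end HardyNorm

lemma eventually_circleAverage_sub_le {p : ℝ} (hp0 : 0 < p) {φ m : ℝ → ℂ → ℂ}
    (hφmap : ∀ t, 0 ≤ t → MapsTo (φ t) (ball 0 1) (ball 0 1))
    (hφan : ∀ t, 0 ≤ t → DifferentiableOn ℂ (φ t) (ball 0 1))
    (hman : ∀ t, 0 ≤ t → DifferentiableOn ℂ (m t) (ball 0 1))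
    {M : ℝ} (hM1 : 1 ≤ M)
    (hM : ∀ᶠ t in 𝓝[>] (0 : ℝ), ∀ z ∈ ball (0 : ℂ) 1, ‖m t z‖ ≤ M)
    (hφ0M : ∀ᶠ t in 𝓝[>] (0 : ℝ), ‖φ t 0‖ ≤ 1 / 2)
    (hsq : ∀ g : ℂ → ℂ, DifferentiableOn ℂ g (ball 0 1) →
      (∃ K, ∀ z ∈ ball (0 : ℂ) 1, ‖g z‖ ≤ K) → ∀ ε > 0, ∀ᶠ t in 𝓝[>] (0 : ℝ),
        ∀ r ∈ Ioo (0 : ℝ) 1,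
          Real.circleAverage (fun z => ‖m t z * g (φ t z) - g z‖ ^ (2 : ℝ)) 0 r ≤ ε)
    {f : ℂ → ℂ} (hf : MemHardy p f) {η : ℝ} (hη : 0 < η) :
    ∀ᶠ t in 𝓝[>] (0 : ℝ), ∀ r ∈ Ioo (0 : ℝ) 1,
      Real.circleAverage (fun z => ‖m t z * f (φ t z) - f z‖ ^ p) 0 r ≤ η := by
  have hM0 : 0 < M := by linarith
  obtain ⟨η', hη', hηη'⟩ : ∃ η' > 0, 3 ^ p * (M ^ p * (4 * η')) + (3 ^ p * (2 * η') + 3 ^ p * η') ≤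
      η := by
    refine ⟨η / (3 ^ p * (M ^ p * 4 + 3)), by positivity, le_of_eq ?_⟩
    field_simp
    ring
  obtain ⟨g, K, hg, hgK, hfg⟩ :=
    exists_bounded_circleAverage_sub_le hf.1 hp0 hf.circleAverage_le hη'
  have hK0 : 0 ≤ K := (norm_nonneg _).trans (hgK 0 (mem_ball_self one_pos))
  obtain ⟨c, hc, hcK⟩ := exists_rpow_le_add_mul_sq hp0 (K := M * K + K) (by positivity) hη'
  filter_upwards [hM, hφ0M, hsq g hg ⟨K, hgK⟩ (η' / (c + 1)) (by positivity),
    self_mem_nhdsWithin] with t htM htφ htsq ht r hr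
  have ht0 : 0 ≤ t := le_of_lt ht
  have hcomp : ∀ {h : ℂ → ℂ}, DifferentiableOn ℂ h (ball 0 1) →
      ContinuousOn (fun z => m t z * h (φ t z)) (ball 0 1) := fun hh =>
    (hman t ht0).continuousOn.mul (hh.continuousOn.comp (hφan t ht0).continuousOn (hφmap t ht0))
  have hdiff : DifferentiableOn ℂ (fun z => f z - g z) (ball 0 1) := hf.1.sub hg
  have hu := continuousOn_rpow_norm (hcomp hdiff) hp0
  have hvb : ContinuousOn (fun z => m t z * g (φ t z) - g z) (ball 0 1) :=
    (hcomp hg).sub hg.continuousOn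
  have hv := continuousOn_rpow_norm hvb hp0
  have hv2 := continuousOn_rpow_norm hvb two_pos
  have hw := continuousOn_rpow_norm hdiff.continuousOn hp0
  have havg1 : Real.circleAverage (fun z => ‖m t z * (f (φ t z) - g (φ t z))‖ ^ p) 0 r ≤
      M ^ p * (4 * η') := by
    refine (circleAverage_weighted_comp_le hdiff hp0 hfg (hφan t ht0) (hφmap t ht0) (hman t ht0)
      htM hr).trans ?_
    gcongr
    rw [div_le_iff₀ (by linarith)]
    nlinarith
  have havg2 : Real.circleAverage (fun z => ‖m t z * g (φ t z) - g z‖ ^ p) 0 r ≤ 2 * η' := by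
    refine (circleAverage_le_of_le_on_ball hv
      (v := fun z => η' * 1 + c * ‖m t z * g (φ t z) - g z‖ ^ (2 : ℝ))
      (by fun_prop) (fun z hz => ?_) hr).trans ?_
    · rw [mul_one]
      refine hcK _ (norm_nonneg _) ((norm_sub_le _ _).trans ?_)
      rw [norm_mul]
      have h1 := htM z hz
      have h2 := hgK z hz
      have h3 := hgK _ (hφmap t ht0 hz)
      gcongr
    · rw [circleAverage_const_mul_add continuousOn_const hv2 _ _ hr, Real.circleAverage_const]
      have h1 := mul_le_mul_of_nonneg_left (htsq r hr) hc
      have h2 : c * (η' / (c + 1)) ≤ η' := by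
        rw [mul_div_assoc', div_le_iff₀ (by positivity)]
        nlinarith
      linarith
  have hvw : ContinuousOn (fun z => 3 ^ p * ‖m t z * g (φ t z) - g z‖ ^ p +
      3 ^ p * ‖f z - g z‖ ^ p) (ball 0 1) := by fun_prop
  calc _ ≤ Real.circleAverage (fun z => 3 ^ p * ‖m t z * (f (φ t z) - g (φ t z))‖ ^ p +
        1 * (3 ^ p * ‖m t z * g (φ t z) - g z‖ ^ p + 3 ^ p * ‖f z - g z‖ ^ p)) 0 r := by
        refine circleAverage_le_of_le_on_ball
          (continuousOn_rpow_norm ((hcomp hf.1).sub hf.1.continuousOn) hp0)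
          ((continuousOn_const.mul hu).add (continuousOn_const.mul hvw)) (fun z _ => ?_) hr
        refine le_of_eq_of_le ?_ (rpow_norm_add_sub_le hp0 _ _ _)
        congr 2
        simp only [Pi.sub_apply]
        ring
    _ = 3 ^ p * Real.circleAverage (fun z => ‖m t z * (f (φ t z) - g (φ t z))‖ ^ p) 0 r +
        (3 ^ p * Real.circleAverage (fun z => ‖m t z * g (φ t z) - g z‖ ^ p) 0 r +
          3 ^ p * Real.circleAverage (fun z => ‖f z - g z‖ ^ p) 0 r) := by
        rw [circleAverage_const_mul_add hu hvw _ _ hr, circleAverage_const_mul_add hv hw _ _ hr,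
          one_mul]
    _ ≤ 3 ^ p * (M ^ p * (4 * η')) + (3 ^ p * (2 * η') + 3 ^ p * η') := by
        have := hfg r hr
        gcongr
    _ ≤ η := hηη'

/-- Let `1 ≤ p < ∞`.  Suppose `(φ_t)` is a semigroup of analytic self-maps
of `𝔻` and `(m_t)` is a pointwise continuous cocycle for `(φ_t)`.  If
`limsup_{t→0⁺} ‖m_t‖_{H^∞} < ∞` (i.e. the sup norms of the `m_t` are eventually uniformly
bounded as `t → 0⁺`), then each `m_t` is bounded on `𝔻`, each weighted composition operator
`S_t f = m_t · (f ∘ φ_t)` is bounded on `H^p`, and `(S_t)` is strongly continuous on `H^p`. -/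
theorem stmt4 (p : ℝ) (hp : 1 ≤ p)
    (φ m : ℝ → ℂ → ℂ)
    -- `(φ_t)` is a semigroup of analytic self-maps of the unit disk
    (hφmap : ∀ t, 0 ≤ t → Set.MapsTo (φ t) (Metric.ball (0:ℂ) 1) (Metric.ball (0:ℂ) 1))
    (hφan : ∀ t, 0 ≤ t → DifferentiableOn ℂ (φ t) (Metric.ball 0 1))
    (hφ0 : ∀ z ∈ Metric.ball (0:ℂ) 1, φ 0 z = z)
    (hφsemi : ∀ s, 0 ≤ s → ∀ t, 0 ≤ t → ∀ z ∈ Metric.ball (0:ℂ) 1,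
      φ (t + s) z = φ t (φ s z))
    (hφcont : ∀ z ∈ Metric.ball (0:ℂ) 1, Tendsto (fun t => φ t z) (𝓝[>] (0:ℝ)) (𝓝 z))
    -- `(m_t)` is a pointwise continuous cocycle for `(φ_t)`
    (hman : ∀ t, 0 ≤ t → DifferentiableOn ℂ (m t) (Metric.ball 0 1))
    (hm0 : ∀ z ∈ Metric.ball (0:ℂ) 1, m 0 z = 1)
    (hmcoc : ∀ s, 0 ≤ s → ∀ t, 0 ≤ t → ∀ z ∈ Metric.ball (0:ℂ) 1,
      m (t + s) z = m t z * m s (φ t z))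
    (hmcont : ∀ z ∈ Metric.ball (0:ℂ) 1, Tendsto (fun t => m t z) (𝓝[>] (0:ℝ)) (𝓝 1))
    -- `limsup_{t→0⁺} ‖m_t‖_{H^∞} < ∞`
    (hlimsup : ∃ M : ℝ, ∀ᶠ t in 𝓝[>] (0:ℝ), ∀ z ∈ Metric.ball (0:ℂ) 1, ‖m t z‖ ≤ M) :
    -- each `m_t` is bounded on `𝔻`
    (∀ t, 0 ≤ t → ∃ C : ℝ, ∀ z ∈ Metric.ball (0:ℂ) 1, ‖m t z‖ ≤ C) ∧
    -- each `S_t` maps `H^p` into `H^p` boundedly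
    (∀ t, 0 ≤ t → ∀ f, MemHardy p f → MemHardy p (fun z => m t z * f (φ t z))) ∧
    (∀ t, 0 ≤ t → ∃ C : ℝ, ∀ f, MemHardy p f →
      hardyNorm p (fun z => m t z * f (φ t z)) ≤ C * hardyNorm p f) ∧
    -- `(S_t)` is strongly continuous on `H^p`
    (∀ f, MemHardy p f →
      Tendsto (fun t => hardyNorm p (fun z => m t z * f (φ t z) - f z)) (𝓝[>] (0:ℝ)) (𝓝 0)) := by
  have hp0 : 0 < p := by linarith
  obtain ⟨M, hM⟩ := hlimsup
  have hbdd : ∀ t, 0 ≤ t → ∃ C : ℝ, ∀ z ∈ ball (0 : ℂ) 1, ‖m t z‖ ≤ C := fun t ht =>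
    cocycle_bounded hφmap hm0 hmcoc hM ht
  have hmean : ∀ t (_ : 0 ≤ t) (C : ℝ), (∀ z ∈ ball (0 : ℂ) 1, ‖m t z‖ ≤ C) → ∀ f, MemHardy p f →
      ∀ r ∈ Ioo (0 : ℝ) 1, Real.circleAverage (fun z => ‖m t z * f (φ t z)‖ ^ p) 0 r ≤
        C ^ p * (2 * (⨆ r : Ioo (0 : ℝ) 1, hardyMeanP p f (r : ℝ)) / (1 - ‖φ t 0‖)) :=
    fun t ht C hC f hf r hr => circleAverage_weighted_comp_le hf.1 hp0 hf.circleAverage_le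
      (hφan t ht) (hφmap t ht) (hman t ht) hC hr
  refine ⟨hbdd, fun t ht f hf => ?_, fun t ht => ?_, fun f hf => ?_⟩
  · obtain ⟨C, hC⟩ := hbdd t ht
    exact memHardy_of_circleAverage_le
      ((hman t ht).mul (hf.1.comp (hφan t ht) (hφmap t ht))) (hmean t ht C hC f hf)
  · obtain ⟨C, hC⟩ := hbdd t ht
    have hC0 : 0 ≤ C := (norm_nonneg _).trans (hC 0 (mem_ball_self one_pos))
    have hφt : 0 < 1 - ‖φ t 0‖ := by
      have := hφmap t ht (mem_ball_self one_pos)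
      rw [mem_ball_zero_iff] at this
      linarith
    refine ⟨(C ^ p * (2 / (1 - ‖φ t 0‖))) ^ (1 / p), fun f hf => ?_⟩
    refine (hardyNorm_le hp0 (hmean t ht C hC f hf)).trans (le_of_eq ?_)
    rw [hardyNorm, ← Real.mul_rpow (by positivity) (iSup_hardyMeanP_nonneg p f)]
    congr 1
    ring
  · have hM' : ∀ᶠ t in 𝓝[>] (0 : ℝ), ∀ z ∈ ball (0 : ℂ) 1, ‖m t z‖ ≤ max M 1 := by
      filter_upwards [hM] with t ht z hz
      exact (ht z hz).trans (le_max_left _ _)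
    have hφ0M : ∀ᶠ t in 𝓝[>] (0 : ℝ), ‖φ t 0‖ ≤ 1 / 2 := by
      have h := (hφcont 0 (mem_ball_self one_pos)).norm
      rw [norm_zero] at h
      exact h.eventually (ge_mem_nhds (by norm_num))
    refine tendsto_order.2 ⟨fun a ha => Eventually.of_forall fun t =>
      ha.trans_le (hardyNorm_nonneg p _), fun ε hε => ?_⟩
    have hε2 : 0 < ε / 2 := by positivity
    filter_upwards [eventually_circleAverage_sub_le hp0 hφmap hφan hman (le_max_right M 1) hM' hφ0M
      (fun g hg ⟨K, hK⟩ η hη => eventually_circleAverage_sq_sub_le hφmap hφan hφ0 hφsemi hφcont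
        hman hm0 hmcoc hmcont (le_max_right M 1) hM' hφ0M hbdd hg (B := K ^ (2 : ℝ)) (fun r hr => by
          refine (circleAverage_le_of_le_on_ball (continuousOn_rpow_norm hg.continuousOn two_pos)
            continuousOn_const (fun z hz => ?_) hr).trans_eq (Real.circleAverage_const _ _ _)
          have := hK z hz
          gcongr) hη)
      hf (η := (ε / 2) ^ p) (by positivity)] with t ht
    refine (hardyNorm_le hp0 ht).trans_lt ?_
    rw [← Real.rpow_mul hε2.le, mul_one_div_cancel hp0.ne', Real.rpow_one]
    linarith
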